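/- arXiv:2211.10349 — 3 statements merged into one kernel-verified Lean document; each statement's English description precedes it below -/
import Mathlib

section
/- Let n, m, k ∈ ℕ and let B : 𝓢(ℝ^n) × 𝓢(ℝ^m) → 𝓢(ℝ^k) be a bilinear map that is separately continuous (for each fixed f ∈ 𝓢(ℝ^n) the map ψ ↦ B(f,ψ) is continuous, and for each fixed ψ ∈ 𝓢(ℝ^m) the map f ↦ B(f,ψ) is continuous). Then there exists a unique continuous linear map F : 𝓢(ℝ^{n+m}) → 𝓢(ℝ^k) such that F(f ⊠ ψ) = B(f,ψ) for all f ∈ 𝓢(ℝ^n), ψ ∈ 𝓢(ℝ^m). -/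
noncomputable section

/-- `ℝ^d`. -/
abbrev Euc (d : ℕ) : Type := EuclideanSpace ℝ (Fin d)

namespace SchwartzKernel

open scoped SchwartzMap FourierTransform ContDiff
open Filter Topology MeasureTheory

section Seminorms

variable {E F : Type*} [NormedAddCommGroup E] [NormedSpace ℝ E]
  [NormedAddCommGroup F] [NormedSpace ℝ F] [NormedSpace ℂ F] [SMulCommClass ℝ ℂ F]

variable (E F) in
/-- The increasing sequence of seminorms `sup_{k, n ≤ N} ‖·‖_{k, n}` on Schwartz space. -/
def supSeminorm (N : ℕ) : Seminorm ℂ 𝓢(E, F) :=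
  (Finset.Iic (N, N)).sup (schwartzSeminormFamily ℂ E F)

theorem continuous_seminorm (k n : ℕ) : Continuous (SchwartzMap.seminorm ℂ k n : 𝓢(E, F) → ℝ) :=
  (schwartz_withSeminorms ℂ E F).continuous_seminorm (k, n)

theorem continuous_supSeminorm (N : ℕ) : Continuous (supSeminorm E F N) := by
  rw [supSeminorm]
  induction Finset.Iic (N, N) using Finset.induction_on with
  | empty => simpa using! continuous_const
  | insert a s _ ih =>
    rw [Finset.sup_insert]
    exact (continuous_seminorm a.1 a.2).sup ih

theorem seminorm_le_supSeminorm {k n N : ℕ} (hk : k ≤ N) (hn : n ≤ N) (f : 𝓢(E, F)) :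
    SchwartzMap.seminorm ℂ k n f ≤ supSeminorm E F N f :=
  Seminorm.le_def.1 (Finset.le_sup (f := schwartzSeminormFamily ℂ E F)
    (Finset.mem_Iic.2 (Prod.mk_le_mk.2 ⟨hk, hn⟩))) f

theorem supSeminorm_le {N : ℕ} {f : 𝓢(E, F)} {C : ℝ} (hC : 0 ≤ C)
    (h : ∀ k ≤ N, ∀ n ≤ N, SchwartzMap.seminorm ℂ k n f ≤ C) : supSeminorm E F N f ≤ C :=
  Seminorm.finset_sup_apply_le hC fun i hi ↦
    h i.1 (Finset.mem_Iic.1 hi).1 i.2 (Finset.mem_Iic.1 hi).2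

theorem supSeminorm_mono {M N : ℕ} (h : M ≤ N) (f : 𝓢(E, F)) :
    supSeminorm E F M f ≤ supSeminorm E F N f :=
  supSeminorm_le (apply_nonneg _ _) fun _ hk _ hn ↦
    seminorm_le_supSeminorm (hk.trans h) (hn.trans h) f

theorem one_add_norm_pow_mul_iteratedFDeriv_le {k n N : ℕ} (hk : k ≤ N) (hn : n ≤ N)
    (f : 𝓢(E, F)) (x : E) :
    (1 + ‖x‖) ^ k * ‖iteratedFDeriv ℝ n f x‖ ≤ 2 ^ N * supSeminorm E F N f :=
  SchwartzMap.one_add_le_sup_seminorm_apply (m := (N, N)) hk hn f x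

theorem exists_le_supSeminorm (p : Seminorm ℂ 𝓢(E, F)) (hp : Continuous p) :
    ∃ (N : ℕ) (C : ℝ), 0 < C ∧ ∀ f, p f ≤ C * supSeminorm E F N f := by
  obtain ⟨s, C, hC, h⟩ := Seminorm.bound_of_continuous (schwartz_withSeminorms ℂ E F) p hp
  refine ⟨s.sup fun i ↦ max i.1 i.2, C, by positivity, fun f ↦ (h f).trans ?_⟩
  rw [_root_.smul_apply, NNReal.smul_def, smul_eq_mul]
  gcongr
  refine Seminorm.finset_sup_apply_le (apply_nonneg _ _) fun i hi ↦ ?_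
  have := Finset.le_sup (f := fun i : ℕ × ℕ ↦ max i.1 i.2) hi
  exact seminorm_le_supSeminorm ((le_max_left _ _).trans this) ((le_max_right _ _).trans this) f

theorem setOf_supSeminorm_lt_mem_nhds (N : ℕ) {r : ℝ} (hr : 0 < r) :
    {f | supSeminorm E F N f < r} ∈ 𝓝 (0 : 𝓢(E, F)) :=
  (continuous_supSeminorm N).continuousAt.eventually_lt continuousAt_const (by simpa using hr)

theorem exists_setOf_supSeminorm_lt_subset {s : Set 𝓢(E, F)} (hs : s ∈ 𝓝 0) :
    ∃ N, ∃ r > 0, {f | supSeminorm E F N f < r} ⊆ s := by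
  obtain ⟨i, r, hr, h⟩ := ((schwartz_withSeminorms ℂ E F).mem_nhds_iff 0 s).1 hs
  refine ⟨i.sup fun i ↦ max i.1 i.2, r, hr, fun f hf ↦ h ?_⟩
  rw [Seminorm.mem_ball_zero]
  refine lt_of_le_of_lt ?_ hf
  refine Seminorm.finset_sup_apply_le (apply_nonneg _ _) fun j hj ↦ ?_
  have := Finset.le_sup (f := fun i : ℕ × ℕ ↦ max i.1 i.2) hj
  exact seminorm_le_supSeminorm ((le_max_left _ _).trans this) ((le_max_right _ _).trans this) f

theorem tendsto_of_supSeminorm {α : Type*} {l : Filter α} {u : α → 𝓢(E, F)} {f : 𝓢(E, F)}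
    (h : ∀ N, Tendsto (fun a ↦ supSeminorm E F N (u a - f)) l (𝓝 0)) : Tendsto u l (𝓝 f) := by
  rw [← tendsto_sub_nhds_zero_iff]
  intro s hs
  obtain ⟨N, r, hr, hNr⟩ := exists_setOf_supSeminorm_lt_subset hs
  filter_upwards [(h N).eventually_lt_const hr] with a ha using hNr ha

theorem hasSum_apply {α : Type*} {f : α → 𝓢(E, F)} {g : 𝓢(E, F)} (h : HasSum f g) (x : E) :
    HasSum (fun a ↦ f a x) (g x) :=
  h.map ((BoundedContinuousFunction.evalCLM ℂ x).comp
    (SchwartzMap.toBoundedContinuousFunctionCLM ℂ E F))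
    (ContinuousLinearMap.continuous _)

instance : (uniformity 𝓢(E, F)).IsCountablyGenerated :=
  IsUniformAddGroup.uniformity_countably_generated

variable [CompleteSpace F]

theorem exists_seminorm_le_tsum {α : Type*} (f : α → 𝓢(E, F))
    (hf : ∀ N, Summable fun a ↦ supSeminorm E F N (f a)) :
    ∃ g : 𝓢(E, F), (∀ x, HasSum (fun a ↦ f a x) (g x)) ∧
      ∀ N, supSeminorm E F N g ≤ ∑' a, supSeminorm E F N (f a) := by
  have bound (k : ℕ) (a : α) (x : E) :
      ‖iteratedFDeriv ℝ k (f a) x‖ ≤ supSeminorm E F k (f a) :=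
    (SchwartzMap.norm_iteratedFDeriv_le_seminorm ℂ (f a) k x).trans
      (seminorm_le_supSeminorm (Nat.zero_le _) le_rfl _)
  have cd (a : α) : ContDiff ℝ ∞ (f a) := (f a).smooth _
  have bound' (k n N : ℕ) (hk : k ≤ N) (hn : n ≤ N) (x : E) :
      ‖x‖ ^ k * ‖iteratedFDeriv ℝ n (fun x ↦ ∑' a, f a x) x‖ ≤
        ∑' a, supSeminorm E F N (f a) := by
    rw [iteratedFDeriv_tsum_apply (N := ⊤) cd (fun k _ ↦ hf k) (fun k a x _ ↦ bound k a x) le_top]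
    have h1 (a : α) : ‖x‖ ^ k * ‖iteratedFDeriv ℝ n (f a) x‖ ≤ supSeminorm E F N (f a) :=
      (SchwartzMap.le_seminorm ℂ k n (f a) x).trans (seminorm_le_supSeminorm hk hn _)
    have h2 : Summable fun a ↦ ‖iteratedFDeriv ℝ n (f a) x‖ :=
      (hf n).of_nonneg_of_le (fun _ ↦ norm_nonneg _) fun a ↦ bound n a x
    calc _ ≤ ‖x‖ ^ k * ∑' a, ‖iteratedFDeriv ℝ n (f a) x‖ := by
          gcongr; exact norm_tsum_le_tsum_norm h2
      _ = ∑' a, ‖x‖ ^ k * ‖iteratedFDeriv ℝ n (f a) x‖ := by rw [tsum_mul_left]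
      _ ≤ _ := (h2.mul_left _).tsum_le_tsum h1 (hf N)
  let g : 𝓢(E, F) :=
    { toFun := fun x ↦ ∑' a, f a x
      smooth' := contDiff_tsum (N := ⊤) cd (fun k _ ↦ hf k) fun k a x _ ↦ bound k a x
      decay' := fun k n ↦ ⟨_, bound' k n (max k n) (le_max_left _ _) (le_max_right _ _)⟩ }
  refine ⟨g, fun x ↦ ?_, fun N ↦ ?_⟩
  · refine Summable.hasSum (.of_norm_bounded (hf 0) fun a ↦ ?_)
    simpa using bound 0 a x
  · have h0 : 0 ≤ ∑' a, supSeminorm E F N (f a) := tsum_nonneg fun a ↦ apply_nonneg _ _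
    exact supSeminorm_le h0 fun k hk n hn ↦
      SchwartzMap.seminorm_le_bound ℂ k n g h0 (bound' k n N hk hn)

theorem exists_hasSum {α : Type*} (f : α → 𝓢(E, F))
    (hf : ∀ N, Summable fun a ↦ supSeminorm E F N (f a)) :
    ∃ g : 𝓢(E, F), HasSum f g := by
  obtain ⟨g, hg, -⟩ := exists_seminorm_le_tsum f hf
  refine ⟨g, tendsto_of_supSeminorm fun N ↦ ?_⟩
  have h0 := tendsto_tsum_compl_atTop_zero fun a ↦ supSeminorm E F N (f a)
  refine squeeze_zero (fun _ ↦ apply_nonneg _ _) (fun s ↦ ?_) h0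
  obtain ⟨g', hg', hle⟩ := exists_seminorm_le_tsum (fun a : {a // a ∉ s} ↦ f a)
    fun N ↦ (hf N).subtype _
  have : g' = g - ∑ a ∈ s, f a := by
    ext x
    have h1 := (s.hasSum_compl_iff (f := fun a ↦ f a x)).1 (hg' x)
    have h2 := h1.unique (hg x)
    simp only [_root_.sub_apply, _root_.sum_apply]
    rw [← h2]; abel
  rw [← neg_sub, map_neg_eq_map, ← this]
  exact hle N

instance : CompleteSpace 𝓢(E, F) := by
  have hU (N : ℕ) : {p : 𝓢(E, F) × 𝓢(E, F) | supSeminorm E F N (p.2 - p.1) < (1 / 2) ^ N} ∈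
      uniformity 𝓢(E, F) := by
    rw [uniformity_eq_comap_nhds_zero]
    exact preimage_mem_comap (setOf_supSeminorm_lt_mem_nhds N (by positivity))
  refine UniformSpace.complete_of_convergent_controlled_sequences _ hU fun u hu ↦ ?_
  obtain ⟨g, hg⟩ := exists_hasSum (fun i ↦ u (i + 1) - u i) fun N ↦ by
    rw [← summable_nat_add_iff N]
    refine (((summable_nat_add_iff N).2 summable_geometric_two)).of_nonneg_of_le
      (fun _ ↦ apply_nonneg _ _) fun i ↦ ?_
    exact (supSeminorm_mono (Nat.le_add_left N i) _).trans
      (hu (i + N) (i + N) (i + N + 1) le_rfl (Nat.le_succ _)).le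
  refine ⟨u 0 + g, ?_⟩
  have := hg.tendsto_sum_nat.const_add (u 0)
  simpa only [Finset.sum_range_sub, add_sub_cancel] using this

end Seminorms

section Bilinear

variable {E E' G : Type*} [NormedAddCommGroup E] [NormedSpace ℝ E] [NormedAddCommGroup E']
  [NormedSpace ℝ E'] [NormedAddCommGroup G] [NormedSpace ℝ G]

/-- A separately continuous bilinear map of Schwartz spaces is jointly bounded. -/
theorem exists_bilinear_bound (B : 𝓢(E, ℂ) →ₗ[ℂ] 𝓢(E', ℂ) →ₗ[ℂ] 𝓢(G, ℂ))
    (hB₁ : ∀ f, Continuous fun ψ ↦ B f ψ) (hB₂ : ∀ ψ, Continuous fun f ↦ B f ψ) (K : ℕ) :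
    ∃ (N : ℕ) (C : ℝ), 0 ≤ C ∧ ∀ f ψ, supSeminorm G ℂ K (B f ψ) ≤
      C * supSeminorm E ℂ N f * supSeminorm E' ℂ N ψ := by
  let A (N : ℕ) : Set 𝓢(E, ℂ) :=
    {f | ∀ ψ, supSeminorm G ℂ K (B f ψ) ≤ N * supSeminorm E' ℂ N ψ}
  have hA (N : ℕ) : IsClosed (A N) := by
    simp only [A, Set.ofPred_forall]
    exact isClosed_iInter fun ψ ↦ isClosed_le ((continuous_supSeminorm K).comp (hB₂ ψ))
      continuous_const
  have hU : ⋃ N, A N = Set.univ := by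
    refine Set.eq_univ_of_forall fun f ↦ Set.mem_iUnion.2 ?_
    obtain ⟨N, C, hC, h⟩ := exists_le_supSeminorm ((supSeminorm G ℂ K).comp (B f))
      ((continuous_supSeminorm K).comp (hB₁ f))
    obtain ⟨M, hM⟩ := exists_nat_ge C
    refine ⟨max M N, fun ψ ↦ (h ψ).trans ?_⟩
    gcongr
    · exact hM.trans (by exact_mod_cast le_max_left _ _)
    · exact supSeminorm_mono (le_max_right _ _) ψ
  obtain ⟨N, f₀, hf₀⟩ := nonempty_interior_of_iUnion_of_closed hA hU
  have hmem : (fun f ↦ f₀ + f) ⁻¹' A N ∈ 𝓝 (0 : 𝓢(E, ℂ)) :=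
    (continuous_const_add f₀).continuousAt.preimage_mem_nhds
      (by simpa using mem_interior_iff_mem_nhds.1 hf₀)
  obtain ⟨M, r, hr, hM⟩ := exists_setOf_supSeminorm_lt_subset hmem
  have key (f : 𝓢(E, ℂ)) (hf : supSeminorm E ℂ M f < r) (ψ : 𝓢(E', ℂ)) :
      supSeminorm G ℂ K (B f ψ) ≤ 2 * N * supSeminorm E' ℂ N ψ := by
    have h1 := hM hf ψ
    have h2 := interior_subset hf₀ ψ
    have h3 : B f ψ = B (f₀ + f) ψ - B f₀ ψ := by simp
    rw [h3]
    refine (map_sub_le_add _ _ _).trans ?_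
    linarith
  refine ⟨max M N, 2 * N / r, by positivity, fun f ψ ↦ ?_⟩
  have key2 (s : ℝ) (hs : supSeminorm E ℂ M f < s) :
      supSeminorm G ℂ K (B f ψ) ≤ 2 * N / r * s * supSeminorm E' ℂ N ψ := by
    have hs0 : 0 < s := (apply_nonneg _ _).trans_lt hs
    have h := key (((r / s : ℝ) : ℂ) • f) (by
      rw [map_smul_eq_mul, Complex.norm_real, Real.norm_of_nonneg (by positivity)]
      calc r / s * supSeminorm E ℂ M f < r / s * s := by gcongr
        _ = r := by field_simp) ψ
    rw [map_smul, LinearMap.smul_apply, map_smul_eq_mul, Complex.norm_real,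
      Real.norm_of_nonneg (by positivity)] at h
    calc supSeminorm G ℂ K (B f ψ) = s / r * (r / s * supSeminorm G ℂ K (B f ψ)) := by field_simp
      _ ≤ s / r * (2 * N * supSeminorm E' ℂ N ψ) := by gcongr
      _ = _ := by ring
  have lim : Tendsto (fun s ↦ 2 * N / r * s * supSeminorm E' ℂ N ψ)
      (𝓝[>] supSeminorm E ℂ M f) (𝓝 (2 * N / r * supSeminorm E ℂ M f * supSeminorm E' ℂ N ψ)) :=
    ((Continuous.tendsto (by fun_prop) _).mono_left nhdsWithin_le_nhds)
  refine (ge_of_tendsto lim (eventually_mem_nhdsWithin.mono key2)).trans ?_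
  gcongr
  · exact supSeminorm_mono (le_max_left _ _) f
  · exact supSeminorm_mono (le_max_right _ _) ψ

end Bilinear

section TimeFrequency

open SchwartzMap (compSubConstCLM smulLeftCLM)
open scoped RealInnerProductSpace

variable {V : Type*} [NormedAddCommGroup V]

theorem one_add_norm_add_le (x y : V) : 1 + ‖x + y‖ ≤ (1 + ‖x‖) * (1 + ‖y‖) := by
  nlinarith [norm_add_le x y, norm_nonneg x, norm_nonneg y,
    mul_nonneg (norm_nonneg x) (norm_nonneg y)]

theorem supSeminorm_compSubConstCLM_le [NormedSpace ℝ V] (N : ℕ) (a : V) (f : 𝓢(V, ℂ)) :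
    supSeminorm V ℂ N (compSubConstCLM ℂ a f) ≤ 2 ^ N * (1 + ‖a‖) ^ N * supSeminorm V ℂ N f := by
  refine supSeminorm_le (by positivity) fun k hk n hn ↦
    SchwartzMap.seminorm_le_bound ℂ k n _ (by positivity) fun x ↦ ?_
  have h1 : iteratedFDeriv ℝ n (compSubConstCLM ℂ a f) x = iteratedFDeriv ℝ n f (x - a) :=
    iteratedFDeriv_comp_sub n a x
  have h2 : ‖x‖ ≤ (1 + ‖a‖) * (1 + ‖x - a‖) := by
    have := one_add_norm_add_le a (x - a)
    rw [add_sub_cancel] at this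
    linarith
  calc ‖x‖ ^ k * ‖iteratedFDeriv ℝ n (compSubConstCLM ℂ a f) x‖
      ≤ ((1 + ‖a‖) * (1 + ‖x - a‖)) ^ k * ‖iteratedFDeriv ℝ n f (x - a)‖ := by rw [h1]; gcongr
    _ = (1 + ‖a‖) ^ k * ((1 + ‖x - a‖) ^ k * ‖iteratedFDeriv ℝ n f (x - a)‖) := by
      rw [mul_pow, mul_assoc]
    _ ≤ (1 + ‖a‖) ^ N * (2 ^ N * supSeminorm V ℂ N f) := by
      gcongr ?_ * ?_
      · exact pow_le_pow_right₀ (by linarith [norm_nonneg a]) hk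
      · exact one_add_norm_pow_mul_iteratedFDeriv_le hk hn f _
    _ = _ := by ring

theorem exists_supSeminorm_smulLeftCLM_le [NormedSpace ℝ V] (φ : 𝓢(V, ℂ)) (N r : ℕ) :
    ∃ (M : ℕ) (C : ℝ), 0 ≤ C ∧ ∀ (a : V) (h : 𝓢(V, ℂ)), (1 + ‖a‖) ^ r *
      supSeminorm V ℂ N (smulLeftCLM ℂ φ (compSubConstCLM ℂ (-a) h)) ≤
        C * supSeminorm V ℂ M h := by
  refine ⟨N + r, 2 ^ N * (2 ^ (N + r) * supSeminorm V ℂ (N + r) φ) * 2 ^ (N + r),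
    by positivity, fun a h ↦ ?_⟩
  rw [← le_div_iff₀' (by positivity)]
  refine supSeminorm_le (by positivity) fun k hk n hn ↦
    SchwartzMap.seminorm_le_bound ℂ k n _ (by positivity) fun x ↦ ?_
  rw [le_div_iff₀' (by positivity)]
  set g := compSubConstCLM ℂ (-a) h with hg
  have e : (smulLeftCLM ℂ φ g : V → ℂ) = fun y ↦ φ y * g y := by
    rw [SchwartzMap.smulLeftCLM_apply φ.hasTemperateGrowth]
    rfl
  have h1 (m : ℕ) : iteratedFDeriv ℝ m g x = iteratedFDeriv ℝ m h (x + a) := by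
    rw [← sub_neg_eq_add]
    exact iteratedFDeriv_comp_sub m (-a) x
  have h2 : 1 + ‖a‖ ≤ (1 + ‖x + a‖) * (1 + ‖x‖) := by
    have := one_add_norm_add_le (x + a) (-x)
    simpa using this
  have h3 := norm_iteratedFDeriv_mul_le (φ.smooth ⊤) (g.smooth ⊤) x (n := n)
    (by exact_mod_cast le_top)
  rw [e]
  calc (1 + ‖a‖) ^ r * (‖x‖ ^ k * ‖iteratedFDeriv ℝ n (fun y ↦ φ y * g y) x‖)
      ≤ ((1 + ‖x + a‖) * (1 + ‖x‖)) ^ r * ((1 + ‖x‖) ^ k * ∑ i ∈ Finset.range (n + 1),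
        (n.choose i : ℝ) * ‖iteratedFDeriv ℝ i φ x‖ * ‖iteratedFDeriv ℝ (n - i) g x‖) := by
        gcongr
        linarith
    _ = ∑ i ∈ Finset.range (n + 1), (n.choose i : ℝ) *
          ((1 + ‖x‖) ^ (k + r) * ‖iteratedFDeriv ℝ i φ x‖) *
          ((1 + ‖x + a‖) ^ r * ‖iteratedFDeriv ℝ (n - i) h (x + a)‖) := by
        simp only [Finset.mul_sum, h1]
        refine Finset.sum_congr rfl fun i _ ↦ ?_
        rw [mul_pow]
        ring
    _ ≤ ∑ i ∈ Finset.range (n + 1), (n.choose i : ℝ) *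
          (2 ^ (N + r) * supSeminorm V ℂ (N + r) φ) *
          (2 ^ (N + r) * supSeminorm V ℂ (N + r) h) := by
        refine Finset.sum_le_sum fun i hi ↦ ?_
        have := Finset.mem_range.1 hi
        exact mul_le_mul (mul_le_mul_of_nonneg_left
          (one_add_norm_pow_mul_iteratedFDeriv_le (by lia) (by lia) φ x) (by positivity))
          (one_add_norm_pow_mul_iteratedFDeriv_le (by lia) (by lia) h (x + a))
          (by positivity) (by positivity)
    _ = 2 ^ n * (2 ^ (N + r) * supSeminorm V ℂ (N + r) φ) *
          (2 ^ (N + r) * supSeminorm V ℂ (N + r) h) := by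
        rw [← Finset.sum_mul, ← Finset.sum_mul]
        norm_cast
        rw [Nat.sum_range_choose]
    _ ≤ 2 ^ N * (2 ^ (N + r) * supSeminorm V ℂ (N + r) φ) *
          (2 ^ (N + r) * supSeminorm V ℂ (N + r) h) := by
        gcongr
        norm_num
    _ = _ := by ring

variable [InnerProductSpace ℝ V] [FiniteDimensional ℝ V] [MeasurableSpace V] [BorelSpace V]

/-- Modulation `x ↦ e^{2πi⟨x, b⟩} f x` of a Schwartz function, as a translation of the Fourier
transform. -/
def modulate (b : V) (f : 𝓢(V, ℂ)) : 𝓢(V, ℂ) := 𝓕⁻ (compSubConstCLM ℂ b (𝓕 f))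

theorem modulate_apply (b : V) (f : 𝓢(V, ℂ)) (x : V) :
    modulate b f x = Complex.exp (2 * Real.pi * ⟪x, b⟫ * Complex.I) * f x := by
  conv_rhs => rw [← FourierTransform.fourierInv_fourier_eq (F := 𝓢(V, ℂ)) f]
  rw [modulate, SchwartzMap.fourierInv_coe, SchwartzMap.fourierInv_coe, Real.fourierInv_eq',
    Real.fourierInv_eq', ← integral_add_right_eq_self _ b, ← integral_const_mul]
  congr with v
  rw [SchwartzMap.compSubConstCLM_apply, add_sub_cancel_right, inner_add_left, smul_eq_mul,
    smul_eq_mul, ← mul_assoc, ← Complex.exp_add, real_inner_comm x b]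
  congr 2
  push_cast
  ring

theorem exists_supSeminorm_modulate_le (f : 𝓢(V, ℂ)) (N : ℕ) :
    ∃ (K : ℕ) (C : ℝ), 0 ≤ C ∧ ∀ b : V, supSeminorm V ℂ N (modulate b f) ≤ C * (1 + ‖b‖) ^ K := by
  obtain ⟨K, C, hC, h⟩ := exists_le_supSeminorm
    ((supSeminorm V ℂ N).comp (FourierTransform.fourierInvCLM ℂ 𝓢(V, ℂ)).toLinearMap)
    ((continuous_supSeminorm N).comp (ContinuousLinearMap.continuous _))
  refine ⟨K, C * (2 ^ K * supSeminorm V ℂ K (𝓕 f)), by positivity, fun b ↦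
    (h (compSubConstCLM ℂ b (𝓕 f))).trans ?_⟩
  grw [supSeminorm_compSubConstCLM_le]
  apply le_of_eq
  ring

/-- The windowed Fourier coefficient `∫ φ(x) h(x + a) e^{-2πi⟨x, b⟩} dx`. -/
def windowCoeff (φ : 𝓢(V, ℂ)) (a b : V) : 𝓢(V, ℂ) →ₗ[ℂ] ℂ where
  toFun h := 𝓕 (smulLeftCLM ℂ φ (compSubConstCLM ℂ (-a) h)) b
  map_add' f g := by simp [FourierTransform.fourier_add]
  map_smul' c f := by simp [FourierTransform.fourier_smul]

theorem exists_windowCoeff_le (φ : 𝓢(V, ℂ)) (r : ℕ) :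
    ∃ (M : ℕ) (C : ℝ), 0 ≤ C ∧ ∀ (a b : V) (h : 𝓢(V, ℂ)),
      (1 + ‖a‖) ^ r * (1 + ‖b‖) ^ r * ‖windowCoeff φ a b h‖ ≤ C * supSeminorm V ℂ M h := by
  obtain ⟨N, C, hC, h1⟩ := exists_le_supSeminorm
    ((supSeminorm V ℂ r).comp (FourierTransform.fourierCLM ℂ 𝓢(V, ℂ)).toLinearMap)
    ((continuous_supSeminorm r).comp (ContinuousLinearMap.continuous _))
  obtain ⟨M, C', hC', h2⟩ := exists_supSeminorm_smulLeftCLM_le φ N r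
  refine ⟨M, 2 ^ r * (C * C'), by positivity, fun a b h ↦ ?_⟩
  set u := smulLeftCLM ℂ φ (compSubConstCLM ℂ (-a) h)
  have h3 := one_add_norm_pow_mul_iteratedFDeriv_le le_rfl (Nat.zero_le r) (𝓕 u) b
  rw [norm_iteratedFDeriv_zero] at h3
  have h4 : supSeminorm V ℂ r (𝓕 u) ≤ C * supSeminorm V ℂ N u := h1 u
  calc (1 + ‖a‖) ^ r * (1 + ‖b‖) ^ r * ‖windowCoeff φ a b h‖
      = (1 + ‖a‖) ^ r * ((1 + ‖b‖) ^ r * ‖𝓕 u b‖) := by rw [mul_assoc]; rfl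
    _ ≤ (1 + ‖a‖) ^ r * (2 ^ r * (C * supSeminorm V ℂ N u)) := by grw [h3, h4]
    _ = 2 ^ r * C * ((1 + ‖a‖) ^ r * supSeminorm V ℂ N u) := by ring
    _ ≤ 2 ^ r * C * (C' * supSeminorm V ℂ M h) := by grw [h2 a h]
    _ = _ := by ring

theorem exists_supSeminorm_compSubConstCLM_modulate_le (χ : 𝓢(V, ℂ)) (N : ℕ) :
    ∃ (K : ℕ) (C : ℝ), 0 ≤ C ∧ ∀ a b : V,
      supSeminorm V ℂ N (compSubConstCLM ℂ a (modulate b χ)) ≤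
        C * ((1 + ‖a‖) ^ K * (1 + ‖b‖) ^ K) := by
  obtain ⟨K, C, hC, h⟩ := exists_supSeminorm_modulate_le χ N
  refine ⟨max N K, 2 ^ N * C, by positivity, fun a b ↦ ?_⟩
  grw [supSeminorm_compSubConstCLM_le, h b]
  have ha : (1 + ‖a‖) ^ N ≤ (1 + ‖a‖) ^ max N K :=
    pow_le_pow_right₀ (by linarith [norm_nonneg a]) (le_max_left _ _)
  have hb : (1 + ‖b‖) ^ K ≤ (1 + ‖b‖) ^ max N K :=
    pow_le_pow_right₀ (by linarith [norm_nonneg b]) (le_max_right _ _)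
  grw [ha, hb]
  apply le_of_eq
  ring

end TimeFrequency

section Summability

variable {ι : Type*} [Fintype ι]

theorem summable_pi_prod {α : Type*} {f : α → ℝ} (h0 : ∀ a, 0 ≤ f a) (hf : Summable f) :
    Summable fun i : ι → α ↦ ∏ k, f (i k) := by
  classical
  refine summable_of_sum_le (c := ∏ _k : ι, ∑' a, f a)
    (fun i ↦ Finset.prod_nonneg fun k _ ↦ h0 _) fun u ↦ ?_
  calc ∑ i ∈ u, ∏ k, f (i k)
      ≤ ∑ i ∈ Fintype.piFinset fun k ↦ u.image fun i ↦ i k, ∏ k, f (i k) :=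
        Finset.sum_le_sum_of_subset_of_nonneg
          (fun i hi ↦ Fintype.mem_piFinset.2 fun k ↦ Finset.mem_image_of_mem _ hi)
          fun i _ _ ↦ Finset.prod_nonneg fun k _ ↦ h0 _
    _ = ∏ k, ∑ a ∈ u.image fun i ↦ i k, f a := (Finset.prod_univ_sum _ _).symm
    _ ≤ ∏ _k : ι, ∑' a, f a :=
        Finset.prod_le_prod (fun k _ ↦ Finset.sum_nonneg fun a _ ↦ h0 a)
          fun k _ ↦ hf.sum_le_tsum _ fun a _ ↦ h0 a

theorem summable_inv_one_add_norm_int : Summable fun z : ℤ ↦ ((1 + ‖z‖) ^ 2)⁻¹ := by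
  refine Summable.of_norm_bounded_eventually (Real.summable_one_div_int_pow.2 one_lt_two) ?_
  filter_upwards [(Set.finite_singleton (0 : ℤ)).compl_mem_cofinite] with z hz
  have hz' : (0 : ℝ) < |(z : ℝ)| := abs_pos.2 (Int.cast_ne_zero.2 hz)
  rw [Real.norm_of_nonneg (by positivity), one_div, Int.norm_eq_abs, ← sq_abs (z : ℝ)]
  gcongr
  linarith

variable (ι) in
theorem exists_summable_inv_one_add_norm_pow :
    ∃ r : ℕ, Summable fun j : ι → ℤ ↦ ((1 + ‖j‖) ^ r)⁻¹ := by
  refine ⟨2 * Fintype.card ι, Summable.of_nonneg_of_le (fun j ↦ by positivity) (fun j ↦ ?_)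
    (summable_pi_prod (fun z ↦ by positivity) summable_inv_one_add_norm_int)⟩
  rw [Finset.prod_inv_distrib, pow_mul, ← Finset.card_univ, ← Finset.prod_const]
  refine inv_anti₀ (Finset.prod_pos fun k _ ↦ by positivity) ?_
  exact Finset.prod_le_prod (fun k _ ↦ by positivity) fun k _ ↦ by gcongr; exact norm_le_pi_norm j k

end Summability

section Windows

/-- A smooth function supported in `[1/8, 7/8]` whose translates by `ℤ / 2` sum to one. -/
def window (t : ℝ) : ℝ :=
  Real.smoothTransition (4 * t - 1 / 2) - Real.smoothTransition (4 * (t - 1 / 2) - 1 / 2)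

theorem contDiff_window : ContDiff ℝ ∞ window :=
  (Real.smoothTransition.contDiff.comp (by fun_prop)).sub
    (Real.smoothTransition.contDiff.comp (by fun_prop))

theorem window_eq_zero {t : ℝ} (ht : t ∉ Set.Ioo (1 / 8 : ℝ) (7 / 8)) : window t = 0 := by
  rw [Set.mem_Ioo, not_and_or, not_lt, not_lt] at ht
  rcases ht with ht | ht
  · rw [window, Real.smoothTransition.zero_of_nonpos (by linarith),
      Real.smoothTransition.zero_of_nonpos (by linarith), sub_zero]
  · rw [window, Real.smoothTransition.one_of_one_le (by linarith),
      Real.smoothTransition.one_of_one_le (by linarith), sub_self]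

theorem exists_finset_sum_window (t : ℝ) : ∃ s : Finset ℤ,
    (∀ j ∉ s, window (t - j / 2) = 0) ∧ ∑ j ∈ s, window (t - j / 2) = 1 := by
  set p := ⌊2 * t⌋
  have h1 : (p : ℝ) ≤ 2 * t := Int.floor_le _
  have h2 : 2 * t < p + 1 := Int.lt_floor_add_one _
  refine ⟨{p - 1, p}, fun j hj ↦ window_eq_zero fun ht ↦ hj ?_, ?_⟩
  · have h3 : ((p - 2 : ℤ) : ℝ) < j := by push_cast; linarith [ht.2]
    have h4 : (j : ℝ) < ((p + 1 : ℤ) : ℝ) := by push_cast; linarith [ht.1]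
    have h5 := Int.cast_lt.1 h3
    have h6 := Int.cast_lt.1 h4
    simp only [Finset.mem_insert, Finset.mem_singleton]
    lia
  · rw [Finset.sum_pair (by lia), window, window,
      Real.smoothTransition.one_of_one_le (x := 4 * (t - ((p - 1 : ℤ) : ℝ) / 2) - 1 / 2)
        (by push_cast; linarith),
      Real.smoothTransition.zero_of_nonpos (x := 4 * (t - (p : ℝ) / 2 - 1 / 2) - 1 / 2)
        (by linarith)]
    push_cast
    ring_nf

/-- A smooth function supported in `[0, 1]` and equal to one on `[1/8, 7/8]`. -/
def plateau : ContDiffBump (1 / 2 : ℝ) := ⟨3 / 8, 1 / 2, by norm_num, by norm_num⟩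

theorem plateau_eq_one {t : ℝ} (ht : t ∈ Set.Ioo (1 / 8 : ℝ) (7 / 8)) : plateau t = 1 := by
  refine plateau.one_of_mem_closedBall ?_
  rw [Metric.mem_closedBall, Real.dist_eq, abs_le, plateau]
  constructor <;> linarith [ht.1, ht.2]

theorem plateau_eq_zero {t : ℝ} (ht : t ∉ Set.Ioo (0 : ℝ) 1) : plateau t = 0 := by
  refine plateau.zero_of_le_dist ?_
  by_contra! h
  rw [Real.dist_eq, abs_lt, plateau] at h
  exact ht ⟨by linarith [h.1], by linarith [h.2]⟩

theorem window_mul_plateau (t : ℝ) : window t * plateau t = window t := by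
  by_cases ht : t ∈ Set.Ioo (1 / 8 : ℝ) (7 / 8)
  · rw [plateau_eq_one ht, mul_one]
  · rw [window_eq_zero ht, zero_mul]

variable {ι : Type*} [Fintype ι]

/-- The Schwartz function `x ↦ ∏ k, ρ (x k)`, for `ρ` smooth and supported in `[0, 1]`. -/
def prodSchwartz (ι : Type*) [Fintype ι] (ρ : ℝ → ℝ) (hρ : ContDiff ℝ ∞ ρ)
    (h0 : ∀ t ∉ Set.Ioo (0 : ℝ) 1, ρ t = 0) :
    𝓢(EuclideanSpace ℝ ι, ℂ) :=
  HasCompactSupport.toSchwartzMap (f := fun x : EuclideanSpace ℝ ι ↦ ∏ k, (ρ (x k) : ℂ))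
    (by
      refine HasCompactSupport.intro ((isCompact_univ_pi fun _ : ι ↦
        isCompact_Icc (a := (0 : ℝ)) (b := 1)).image (PiLp.continuous_toLp 2 _)) fun x hx ↦ ?_
      by_contra h
      refine hx ⟨x.ofLp, fun k _ ↦ ?_, rfl⟩
      by_contra hk
      exact h (Finset.prod_eq_zero (Finset.mem_univ k)
        (by rw [h0 _ fun h ↦ hk (Set.Ioo_subset_Icc_self h), Complex.ofReal_zero])))
    (contDiff_prod fun k _ ↦ Complex.ofRealCLM.contDiff.comp
      (hρ.comp (EuclideanSpace.proj (𝕜 := ℝ) k).contDiff))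

variable (ι) in
/-- The analysis window `x ↦ ∏ k, window (x k)`. -/
def analysisWindow : 𝓢(EuclideanSpace ℝ ι, ℂ) :=
  prodSchwartz ι window contDiff_window fun _ ht ↦
    window_eq_zero fun h ↦ ht ⟨by linarith [h.1], by linarith [h.2]⟩

variable (ι) in
/-- The synthesis window `x ↦ ∏ k, plateau (x k)`. -/
def synthesisWindow : 𝓢(EuclideanSpace ℝ ι, ℂ) :=
  prodSchwartz ι plateau plateau.contDiff fun _ ↦ plateau_eq_zero

theorem analysisWindow_apply (x : EuclideanSpace ℝ ι) :
    analysisWindow ι x = ∏ k, (window (x k) : ℂ) := rfl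

theorem synthesisWindow_apply (x : EuclideanSpace ℝ ι) :
    synthesisWindow ι x = ∏ k, (plateau (x k) : ℂ) := rfl

/-- The half-integer point `j / 2`. -/
def halfPoint (j : ι → ℤ) : EuclideanSpace ℝ ι := WithLp.toLp 2 fun k ↦ (j k : ℝ) / 2

/-- The integer point `l`. -/
def intPoint (l : ι → ℤ) : EuclideanSpace ℝ ι := WithLp.toLp 2 fun k ↦ (l k : ℝ)

theorem hasSum_analysisWindow (x : EuclideanSpace ℝ ι) :
    HasSum (fun j : ι → ℤ ↦ analysisWindow ι (x - halfPoint j)) 1 := by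
  classical
  choose s hs0 hs1 using fun k ↦ exists_finset_sum_window (x k)
  have h1 : ∑ j ∈ Fintype.piFinset s, analysisWindow ι (x - halfPoint j) = 1 := by
    simp only [analysisWindow_apply, PiLp.sub_apply, halfPoint]
    rw [← Finset.prod_univ_sum s fun k j ↦ ((window (x k - j / 2) : ℝ) : ℂ)]
    refine Finset.prod_eq_one fun k _ ↦ ?_
    rw [← Complex.ofReal_sum, hs1, Complex.ofReal_one]
  rw [← h1]
  refine hasSum_sum_of_ne_finset_zero fun j hj ↦ ?_
  obtain ⟨k, hk⟩ := not_forall.1 (mt Fintype.mem_piFinset.2 hj)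
  exact Finset.prod_eq_zero (Finset.mem_univ k) (by simp [halfPoint, hs0 k _ hk])

theorem one_add_norm_le_intPoint (j : ι → ℤ) : 1 + ‖j‖ ≤ 1 + ‖intPoint j‖ := by
  gcongr
  refine (pi_norm_le_iff_of_nonneg (norm_nonneg _)).2 fun k ↦ ?_
  simpa [intPoint, Int.norm_eq_abs] using PiLp.norm_apply_le (intPoint j) k

omit [Fintype ι] in
theorem halfPoint_eq (j : ι → ℤ) : halfPoint j = (1 / 2 : ℝ) • intPoint j := by
  ext k
  simp [halfPoint, intPoint]
  ring

theorem norm_halfPoint (j : ι → ℤ) : ‖halfPoint j‖ = ‖intPoint j‖ / 2 := by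
  rw [halfPoint_eq, norm_smul]
  norm_num
  ring

theorem one_add_norm_le_halfPoint (j : ι → ℤ) : 1 + ‖j‖ ≤ 2 * (1 + ‖halfPoint j‖) := by
  grw [one_add_norm_le_intPoint j, norm_halfPoint]
  linarith

variable (ι) in
theorem exists_one_add_norm_intPoint_le :
    ∃ C : ℝ, 0 ≤ C ∧ ∀ j : ι → ℤ, 1 + ‖intPoint j‖ ≤ C * (1 + ‖j‖) := by
  set L : (ι → ℝ) →L[ℝ] EuclideanSpace ℝ ι :=
    (PiLp.continuousLinearEquiv 2 ℝ fun _ : ι ↦ ℝ).symm.toContinuousLinearMap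
  refine ⟨1 + ‖L‖, by positivity, fun j ↦ ?_⟩
  have h1 : ‖fun k ↦ (j k : ℝ)‖ ≤ ‖j‖ := (pi_norm_le_iff_of_nonneg (norm_nonneg _)).2 fun k ↦ by
    simpa [Int.norm_eq_abs] using norm_le_pi_norm j k
  have h2 : ‖intPoint j‖ ≤ ‖L‖ * ‖fun k ↦ (j k : ℝ)‖ := L.le_opNorm _
  grw [h2, h1]
  nlinarith [norm_nonneg j, norm_nonneg L]

end Windows

section Frame

open SchwartzMap (compSubConstCLM smulLeftCLM)

variable {ι : Type*} [Fintype ι]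

/-- The periodic extension of `H` multiplied by the analysis window, as a function on the torus. -/
def periodization (H : 𝓢(EuclideanSpace ℝ ι, ℂ)) : C(UnitAddTorus ι, ℂ) where
  toFun θ := (∏ k, ((AddCircle.liftIoc 1 0 window (θ k) : ℝ) : ℂ)) *
    H (WithLp.toLp 2 fun k ↦ AddCircle.liftIoc 1 0 (fun t ↦ t * plateau t) (θ k))
  continuous_toFun := by
    have h1 : Continuous (AddCircle.liftIoc (1 : ℝ) 0 window) := by
      refine AddCircle.liftIoc_zero_continuous ?_ contDiff_window.continuous.continuousOn
      rw [window_eq_zero (by norm_num), window_eq_zero (by norm_num)]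
    have h2 : Continuous (AddCircle.liftIoc (1 : ℝ) 0 fun t ↦ t * plateau t) := by
      refine AddCircle.liftIoc_zero_continuous ?_
        (continuous_id.mul plateau.continuous).continuousOn
      rw [zero_mul, plateau_eq_zero (by simp), mul_zero]
    refine (continuous_finsetProd _ fun k _ ↦ Complex.continuous_ofReal.comp
      (h1.comp (continuous_apply k))).mul (H.continuous.comp
        ((PiLp.continuous_toLp 2 _).comp (continuous_pi fun k ↦ h2.comp (continuous_apply k))))

theorem periodization_apply (H : 𝓢(EuclideanSpace ℝ ι, ℂ)) {x : EuclideanSpace ℝ ι}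
    (hx : ∀ k, x k ∈ Set.Ioc (0 : ℝ) 1) :
    periodization H (fun k ↦ (x k : UnitAddCircle)) = analysisWindow ι x * H x := by
  simp only [periodization, ContinuousMap.coe_mk, analysisWindow_apply,
    fun k ↦ AddCircle.liftIoc_zero_coe_apply (f := window) (hx k),
    fun k ↦ AddCircle.liftIoc_zero_coe_apply (f := fun t ↦ t * plateau t) (hx k)]
  by_cases h : ∀ k, x k ∈ Set.Ioo (1 / 8 : ℝ) (7 / 8)
  · simp only [fun k ↦ plateau_eq_one (h k), mul_one]
  · obtain ⟨k, hk⟩ := not_forall.1 h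
    have h0 : ∏ k, (window (x k) : ℂ) = 0 := Finset.prod_eq_zero (Finset.mem_univ k) (by
      rw [window_eq_zero hk, Complex.ofReal_zero])
    rw [h0, zero_mul, zero_mul]

theorem mFourier_coe (l : ι → ℤ) (x : EuclideanSpace ℝ ι) :
    UnitAddTorus.mFourier l (fun k ↦ (x k : UnitAddCircle)) =
      Complex.exp (2 * Real.pi * inner ℝ x (intPoint l) * Complex.I) := by
  simp only [UnitAddTorus.mFourier, ContinuousMap.coe_mk, fourier_coe_apply]
  rw [← Complex.exp_sum, PiLp.inner_apply]
  congr 1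
  push_cast
  rw [Finset.mul_sum, Finset.sum_mul]
  refine Finset.sum_congr rfl fun k _ ↦ ?_
  simp [intPoint]
  ring

theorem windowCoeff_eq_integral {V : Type*} [NormedAddCommGroup V] [InnerProductSpace ℝ V]
    [FiniteDimensional ℝ V] [MeasurableSpace V] [BorelSpace V] (φ : 𝓢(V, ℂ)) (a b : V)
    (h : 𝓢(V, ℂ)) : windowCoeff φ a b h =
      ∫ x, Complex.exp (-2 * Real.pi * inner ℝ x b * Complex.I) * (φ x * h (x + a)) := by
  change 𝓕 (smulLeftCLM ℂ φ (compSubConstCLM ℂ (-a) h)) b = _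
  rw [SchwartzMap.fourier_coe, Real.fourier_eq']
  congr with x
  rw [SchwartzMap.smulLeftCLM_apply_apply φ.hasTemperateGrowth]
  simp

theorem mFourierCoeff_periodization (a : EuclideanSpace ℝ ι) (l : ι → ℤ)
    (h : 𝓢(EuclideanSpace ℝ ι, ℂ)) :
    UnitAddTorus.mFourierCoeff (periodization (compSubConstCLM ℂ (-a) h)) l =
      windowCoeff (analysisWindow ι) a (intPoint l) h := by
  rw [UnitAddTorus.mFourierCoeff_eq_integral _ _ 0, windowCoeff_eq_integral,
    ← (PiLp.volume_preserving_toLp ι).integral_comp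
      (MeasurableEquiv.toLp 2 (ι → ℝ)).measurableEmbedding]
  have hs : MeasurableSet {x : ι → ℝ | ∀ k, x k ∈ Set.Ioc ((0 : ι → ℝ) k) ((0 : ι → ℝ) k + 1)} :=
    MeasurableSet.univ_pi' fun k ↦ measurableSet_Ioc
  rw [← integral_indicator hs]
  congr with x
  by_cases hx : ∀ k, x k ∈ Set.Ioc (0 : ℝ) 1
  · have h1 := periodization_apply (compSubConstCLM ℂ (-a) h) (x := WithLp.toLp 2 x) hx
    have h2 := mFourier_coe (-l) (WithLp.toLp 2 x)
    rw [Set.indicator_of_mem (by simpa using hx), smul_eq_mul, h1, h2]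
    have h3 : intPoint (-l) = -intPoint l := by ext; simp [intPoint]
    rw [h3]
    simp
  · obtain ⟨k, hk⟩ := not_forall.1 hx
    have : analysisWindow ι (WithLp.toLp 2 x) = 0 :=
      Finset.prod_eq_zero (Finset.mem_univ k) (by
        simp only
        rw [window_eq_zero fun h ↦ hk ⟨by linarith [h.1], by linarith [h.2]⟩,
        Complex.ofReal_zero])
    rw [Set.indicator_of_notMem (by simpa using ⟨k, by simpa using hk⟩), this, zero_mul, mul_zero]

variable (ι) in
/-- The index set `ℤ^ι × ℤ^ι` of the frame: twice a position and a frequency. -/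
abbrev FrameIndex : Type _ := (ι → ℤ) × (ι → ℤ)

/-- The elements of the frame: modulated and translated synthesis windows. -/
def frameElt (i : FrameIndex ι) : 𝓢(EuclideanSpace ℝ ι, ℂ) :=
  compSubConstCLM ℂ (halfPoint i.1) (modulate (intPoint i.2) (synthesisWindow ι))

/-- The coefficients of a Schwartz function in the frame. -/
def frameCoeff (i : FrameIndex ι) : 𝓢(EuclideanSpace ℝ ι, ℂ) →ₗ[ℂ] ℂ :=
  windowCoeff (analysisWindow ι) (halfPoint i.1) (intPoint i.2)

/-- The size of an index. -/
def frameWeight (i : FrameIndex ι) : ℝ := (1 + ‖i.1‖) * (1 + ‖i.2‖)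

theorem one_le_frameWeight (i : FrameIndex ι) : 1 ≤ frameWeight i := by
  rw [frameWeight]
  nlinarith [norm_nonneg i.1, norm_nonneg i.2]

theorem frameWeight_pos (i : FrameIndex ι) : 0 < frameWeight i :=
  one_pos.trans_le (one_le_frameWeight i)

variable (ι) in
theorem exists_frameCoeff_le (r : ℕ) : ∃ (M : ℕ) (C : ℝ), 0 ≤ C ∧
    ∀ (i : FrameIndex ι) (h : 𝓢(EuclideanSpace ℝ ι, ℂ)),
      frameWeight i ^ r * ‖frameCoeff i h‖ ≤ C * supSeminorm (EuclideanSpace ℝ ι) ℂ M h := by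
  obtain ⟨M, C, hC, H⟩ := exists_windowCoeff_le (analysisWindow ι) r
  refine ⟨M, 2 ^ r * C, by positivity, fun i h ↦ ?_⟩
  have h1 := H (halfPoint i.1) (intPoint i.2) h
  rw [frameWeight]
  calc ((1 + ‖i.1‖) * (1 + ‖i.2‖)) ^ r * ‖frameCoeff i h‖
      ≤ (2 * (1 + ‖halfPoint i.1‖) * (1 + ‖intPoint i.2‖)) ^ r * ‖frameCoeff i h‖ := by
        grw [one_add_norm_le_halfPoint i.1, one_add_norm_le_intPoint i.2]
    _ = 2 ^ r * ((1 + ‖halfPoint i.1‖) ^ r * (1 + ‖intPoint i.2‖) ^ r * ‖frameCoeff i h‖) := by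
        rw [mul_pow, mul_pow]
        ring
    _ ≤ 2 ^ r * (C * supSeminorm (EuclideanSpace ℝ ι) ℂ M h) := by
        exact mul_le_mul_of_nonneg_left h1 (by positivity)
    _ = _ := by ring

variable (ι) in
theorem exists_supSeminorm_frameElt_le (N : ℕ) : ∃ (K : ℕ) (C : ℝ), 0 ≤ C ∧
    ∀ i : FrameIndex ι,
      supSeminorm (EuclideanSpace ℝ ι) ℂ N (frameElt i) ≤ C * frameWeight i ^ K := by
  obtain ⟨K, C, hC, H⟩ := exists_supSeminorm_compSubConstCLM_modulate_le (synthesisWindow ι) N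
  obtain ⟨A, hA, h1⟩ := exists_one_add_norm_intPoint_le ι
  refine ⟨K, C * (A ^ K * A ^ K), by positivity, fun i ↦ (H _ _).trans ?_⟩
  have h2 : 1 + ‖halfPoint i.1‖ ≤ 1 + ‖intPoint i.1‖ := by
    rw [norm_halfPoint]
    linarith [norm_nonneg (intPoint i.1)]
  grw [h2, h1, h1]
  apply le_of_eq
  rw [frameWeight, mul_pow, mul_pow, mul_pow]
  ring

variable (ι) in
theorem exists_summable_inv_frameWeight_pow :
    ∃ r : ℕ, Summable fun i : FrameIndex ι ↦ (frameWeight i ^ r)⁻¹ := by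
  obtain ⟨r, hr⟩ := exists_summable_inv_one_add_norm_pow ι
  refine ⟨r, (hr.mul_of_nonneg hr (fun j ↦ by positivity) (fun j ↦ by positivity)).congr
    fun i ↦ ?_⟩
  rw [frameWeight, mul_pow, mul_inv]

theorem frameElt_apply (i : FrameIndex ι) (x : EuclideanSpace ℝ ι) :
    frameElt i x = Complex.exp (2 * Real.pi * inner ℝ (x - halfPoint i.1) (intPoint i.2) *
      Complex.I) * synthesisWindow ι (x - halfPoint i.1) := by
  rw [frameElt, SchwartzMap.compSubConstCLM_apply, modulate_apply]

theorem summable_frameCoeff_mul_pow (K : ℕ) (h : 𝓢(EuclideanSpace ℝ ι, ℂ)) :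
    Summable fun i : FrameIndex ι ↦ ‖frameCoeff i h‖ * frameWeight i ^ K := by
  obtain ⟨r, hr⟩ := exists_summable_inv_frameWeight_pow ι
  obtain ⟨M, C, hC, H⟩ := exists_frameCoeff_le ι (r + K)
  refine Summable.of_nonneg_of_le
    (fun i ↦ mul_nonneg (norm_nonneg _) (pow_nonneg (frameWeight_pos i).le _)) (fun i ↦ ?_)
    (hr.mul_left (C * supSeminorm (EuclideanSpace ℝ ι) ℂ M h))
  rw [← div_eq_mul_inv, le_div_iff₀ (pow_pos (frameWeight_pos i) _)]
  refine le_of_eq_of_le ?_ (H i h)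
  ring

theorem hasSum_frameCoeff_mul_frameElt (h : 𝓢(EuclideanSpace ℝ ι, ℂ)) (j : ι → ℤ)
    (x : EuclideanSpace ℝ ι) :
    HasSum (fun l : ι → ℤ ↦ frameCoeff (j, l) h * frameElt (j, l) x)
      (analysisWindow ι (x - halfPoint j) * h x) := by
  simp only [frameElt_apply]
  set y := x - halfPoint j
  by_cases hy : ∀ k, y k ∈ Set.Ioo (0 : ℝ) 1
  · set H := compSubConstCLM ℂ (-halfPoint j) h
    have h1 : Summable (UnitAddTorus.mFourierCoeff (periodization H)) := by
      refine Summable.of_norm ?_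
      have := (summable_frameCoeff_mul_pow 0 h).comp_injective (Prod.mk_right_injective j)
      refine this.congr fun l ↦ ?_
      rw [mFourierCoeff_periodization, Function.comp_apply, pow_zero, mul_one]
      rfl
    have h2 := (UnitAddTorus.hasSum_mFourier_series_apply_of_summable h1
      fun k ↦ (y k : UnitAddCircle)).mul_right (synthesisWindow ι y)
    have h3 : analysisWindow ι y * synthesisWindow ι y = analysisWindow ι y := by
      rw [analysisWindow_apply, synthesisWindow_apply, ← Finset.prod_mul_distrib]
      exact Finset.prod_congr rfl fun k _ ↦ by rw [← Complex.ofReal_mul, window_mul_plateau]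
    have h4 : H y = h x := by simp [H, y]
    rw [periodization_apply H fun k ↦ Set.Ioo_subset_Ioc_self (hy k), mul_right_comm, h3, h4] at h2
    refine h2.congr_fun fun l ↦ ?_
    rw [smul_eq_mul, mFourierCoeff_periodization, mFourier_coe, ← mul_assoc]
    rfl
  · obtain ⟨k, hk⟩ := not_forall.1 hy
    have h1 : synthesisWindow ι y = 0 := Finset.prod_eq_zero (Finset.mem_univ k) (by
      rw [plateau_eq_zero hk, Complex.ofReal_zero])
    have h2 : analysisWindow ι y = 0 := Finset.prod_eq_zero (Finset.mem_univ k) (by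
      rw [← window_mul_plateau, plateau_eq_zero hk, mul_zero, Complex.ofReal_zero])
    simp [h1, h2]

theorem hasSum_frame (h : 𝓢(EuclideanSpace ℝ ι, ℂ)) :
    HasSum (fun i : FrameIndex ι ↦ frameCoeff i h • frameElt i) h := by
  obtain ⟨g, hg⟩ := exists_hasSum (fun i : FrameIndex ι ↦ frameCoeff i h • frameElt i) fun N ↦ by
    obtain ⟨K, C, hC, H⟩ := exists_supSeminorm_frameElt_le ι N
    refine Summable.of_nonneg_of_le (fun i ↦ apply_nonneg _ _) (fun i ↦ ?_)
      ((summable_frameCoeff_mul_pow K h).mul_left C)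
    rw [map_smul_eq_mul, mul_left_comm]
    exact mul_le_mul_of_nonneg_left (H i) (norm_nonneg _)
  suffices g = h by rwa [this] at hg
  ext x
  have h1 := (hasSum_apply hg x).prod_fiberwise fun j ↦ hasSum_frameCoeff_mul_frameElt h j x
  exact h1.unique (by simpa using (hasSum_analysisWindow x).mul_right (h x))

end Frame

section Superposition

variable {E F E' F' : Type*} [NormedAddCommGroup E] [NormedSpace ℝ E]
  [NormedAddCommGroup F] [NormedSpace ℝ F] [NormedSpace ℂ F] [SMulCommClass ℝ ℂ F]
  [NormedAddCommGroup E'] [NormedSpace ℝ E']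
  [NormedAddCommGroup F'] [NormedSpace ℝ F'] [NormedSpace ℂ F'] [SMulCommClass ℝ ℂ F']
  [CompleteSpace F']

omit [CompleteSpace F'] in
theorem continuous_of_supSeminorm_le (Λ : 𝓢(E, F) →ₗ[ℂ] 𝓢(E', F'))
    (h : ∀ N, ∃ (M : ℕ) (C : ℝ), ∀ f, supSeminorm E' F' N (Λ f) ≤ C * supSeminorm E F M f) :
    Continuous Λ := by
  refine continuous_of_continuousAt_zero Λ ?_
  rw [ContinuousAt, map_zero]
  refine tendsto_of_supSeminorm fun N ↦ ?_
  obtain ⟨M, C, hMC⟩ := h N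
  have h0 : Tendsto (fun f ↦ C * supSeminorm E F M f) (𝓝 0) (𝓝 0) := by
    have := ((continuous_supSeminorm (E := E) (F := F) M).tendsto 0).const_mul C
    rwa [map_zero, mul_zero] at this
  exact squeeze_zero (fun _ ↦ apply_nonneg _ _) (fun f ↦ by rw [sub_zero]; exact hMC f) h0

theorem exists_continuousLinearMap_hasSum {α : Type*} {c : α → 𝓢(E, F) →ₗ[ℂ] ℂ}
    {b : α → 𝓢(E', F')} {w : α → ℝ} (hw : Summable w)
    (hcb : ∀ N, ∃ (M : ℕ) (C : ℝ), ∀ a f,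
      ‖c a f‖ * supSeminorm E' F' N (b a) ≤ C * supSeminorm E F M f * w a) :
    ∃ Λ : 𝓢(E, F) →L[ℂ] 𝓢(E', F'), ∀ f, HasSum (fun a ↦ c a f • b a) (Λ f) := by
  have hs (f : 𝓢(E, F)) (N : ℕ) : Summable fun a ↦ supSeminorm E' F' N (c a f • b a) := by
    obtain ⟨M, C, h⟩ := hcb N
    refine Summable.of_nonneg_of_le (fun a ↦ apply_nonneg _ _) (fun a ↦ ?_)
      (hw.mul_left (C * supSeminorm E F M f))
    rw [map_smul_eq_mul]
    exact h a f
  choose Λ hΛ using fun f ↦ exists_hasSum _ (hs f)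
  let Λ' : 𝓢(E, F) →ₗ[ℂ] 𝓢(E', F') :=
    { toFun := Λ
      map_add' := fun f g ↦ (hΛ (f + g)).unique (by
        simpa only [map_add, add_smul] using (hΛ f).add (hΛ g))
      map_smul' := fun z f ↦ (hΛ (z • f)).unique (by
        simpa only [map_smul, smul_assoc, RingHom.id_apply] using (hΛ f).const_smul z) }
  refine ⟨⟨Λ', continuous_of_supSeminorm_le Λ' fun N ↦ ?_⟩, hΛ⟩
  obtain ⟨M, C, h⟩ := hcb N
  refine ⟨M, C * ∑' a, w a, fun f ↦ ?_⟩
  obtain ⟨g, hg, hle⟩ := exists_seminorm_le_tsum _ (hs f)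
  have hg' : Λ f = g := by
    ext x
    exact (hasSum_apply (hΛ f) x).unique (hg x)
  calc supSeminorm E' F' N (Λ f) ≤ ∑' a, supSeminorm E' F' N (c a f • b a) := hg' ▸ hle N
    _ ≤ ∑' a, C * supSeminorm E F M f * w a :=
        (hs f N).tsum_le_tsum (fun a ↦ by rw [map_smul_eq_mul]; exact h a f) (hw.mul_left _)
    _ = _ := by rw [tsum_mul_left]; ring

end Superposition

section Tensor

open SchwartzMap (compCLMOfContinuousLinearEquiv)

variable {ι κ : Type*} [Fintype ι] [Fintype κ]

theorem volume_preserving_sumEquivProd :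
    MeasurePreserving (EuclideanSpace.sumEquivProd (𝕜 := ℝ) (ι := ι) (κ := κ)) :=
  (WithLp.volume_preserving_ofLp _ _).comp
    (PiLp.sumPiLpEquivProdLpPiLp (𝕜 := ℝ) 2 fun _ : ι ⊕ κ ↦ ℝ).measurePreserving

/-- The part of a frame index on the first summand. -/
def FrameIndex.inl (i : FrameIndex (ι ⊕ κ)) : FrameIndex ι := (i.1 ∘ Sum.inl, i.2 ∘ Sum.inl)

/-- The part of a frame index on the second summand. -/
def FrameIndex.inr (i : FrameIndex (ι ⊕ κ)) : FrameIndex κ := (i.1 ∘ Sum.inr, i.2 ∘ Sum.inr)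

variable (ι κ) in
/-- A frame index on a disjoint union is a pair of frame indices. -/
def frameIndexEquiv : FrameIndex (ι ⊕ κ) ≃ FrameIndex ι × FrameIndex κ :=
  ((Equiv.sumArrowEquivProdArrow ι κ ℤ).prodCongr (Equiv.sumArrowEquivProdArrow ι κ ℤ)).trans
    (Equiv.prodProdProdComm _ _ _ _)

omit [Fintype ι] [Fintype κ] in
theorem frameIndexEquiv_apply (i : FrameIndex (ι ⊕ κ)) : frameIndexEquiv ι κ i = (i.inl, i.inr) :=
  rfl

theorem norm_comp_le {α β : Type*} [Fintype α] [Fintype β] (j : β → ℤ) (g : α → β) :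
    ‖j ∘ g‖ ≤ ‖j‖ :=
  (pi_norm_le_iff_of_nonneg (norm_nonneg _)).2 fun k ↦ norm_le_pi_norm j (g k)

theorem frameWeight_inl_le (i : FrameIndex (ι ⊕ κ)) : frameWeight i.inl ≤ frameWeight i := by
  unfold frameWeight
  gcongr
  · exact norm_comp_le i.1 _
  · exact norm_comp_le i.2 _

theorem frameWeight_inr_le (i : FrameIndex (ι ⊕ κ)) : frameWeight i.inr ≤ frameWeight i := by
  unfold frameWeight
  gcongr
  · exact norm_comp_le i.1 _
  · exact norm_comp_le i.2 _

theorem inner_eq_inner_sumEquivProd (x y : EuclideanSpace ℝ (ι ⊕ κ)) :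
    inner ℝ x y = inner ℝ (EuclideanSpace.sumEquivProd x).1 (EuclideanSpace.sumEquivProd y).1 +
      inner ℝ (EuclideanSpace.sumEquivProd x).2 (EuclideanSpace.sumEquivProd y).2 := by
  simp only [PiLp.inner_apply, Fintype.sum_sum_type]
  rfl

theorem frameElt_sum (i : FrameIndex (ι ⊕ κ)) (x : EuclideanSpace ℝ (ι ⊕ κ)) :
    frameElt i x = frameElt i.inl (EuclideanSpace.sumEquivProd x).1 *
      frameElt i.inr (EuclideanSpace.sumEquivProd x).2 := by
  simp only [frameElt_apply, synthesisWindow_apply, Fintype.prod_sum_type]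
  rw [inner_eq_inner_sumEquivProd, Complex.ofReal_add, mul_add, add_mul, Complex.exp_add,
    mul_mul_mul_comm]
  rfl

theorem frameCoeff_sum (i : FrameIndex (ι ⊕ κ)) (f : 𝓢(EuclideanSpace ℝ ι, ℂ))
    (ψ : 𝓢(EuclideanSpace ℝ κ, ℂ)) (h : 𝓢(EuclideanSpace ℝ (ι ⊕ κ), ℂ))
    (hh : ∀ x, h x = f (EuclideanSpace.sumEquivProd x).1 * ψ (EuclideanSpace.sumEquivProd x).2) :
    frameCoeff i h = frameCoeff i.inl f * frameCoeff i.inr ψ := by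
  simp only [frameCoeff, windowCoeff_eq_integral]
  rw [← integral_prod_mul, ← Measure.volume_eq_prod,
    ← volume_preserving_sumEquivProd.integral_comp
      EuclideanSpace.sumEquivProd.toHomeomorph.measurableEmbedding]
  congr with x
  simp only [hh, analysisWindow_apply, Fintype.prod_sum_type]
  rw [inner_eq_inner_sumEquivProd, Complex.ofReal_add, mul_add, add_mul, Complex.exp_add,
    mul_mul_mul_comm (Finset.prod _ _) _ (f _), mul_mul_mul_comm (Complex.exp _)]
  rfl

theorem existsUnique_tensor_extension {G : Type*} [NormedAddCommGroup G] [NormedSpace ℝ G]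
    (B : 𝓢(EuclideanSpace ℝ ι, ℂ) →ₗ[ℂ] 𝓢(EuclideanSpace ℝ κ, ℂ) →ₗ[ℂ] 𝓢(G, ℂ))
    (hB₁ : ∀ f, Continuous fun ψ ↦ B f ψ) (hB₂ : ∀ ψ, Continuous fun f ↦ B f ψ) :
    ∃! Λ : 𝓢(EuclideanSpace ℝ ι × EuclideanSpace ℝ κ, ℂ) →L[ℂ] 𝓢(G, ℂ),
      ∀ f ψ h, (∀ x y, h (x, y) = f x * ψ y) → Λ h = B f ψ := by
  let T := compCLMOfContinuousLinearEquiv ℂ (F := ℂ)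
    (EuclideanSpace.sumEquivProd (𝕜 := ℝ) (ι := ι) (κ := κ))
  let T' := compCLMOfContinuousLinearEquiv ℂ (F := ℂ)
    (EuclideanSpace.sumEquivProd (𝕜 := ℝ) (ι := ι) (κ := κ)).symm
  let b (i : FrameIndex (ι ⊕ κ)) : 𝓢(G, ℂ) := B (frameElt i.inl) (frameElt i.inr)
  obtain ⟨r, hr⟩ := exists_summable_inv_frameWeight_pow (ι ⊕ κ)
  have hb (N : ℕ) : ∃ (K : ℕ) (C : ℝ), 0 ≤ C ∧
      ∀ i, supSeminorm G ℂ N (b i) ≤ C * frameWeight i ^ K := by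
    obtain ⟨M, C, hC, h⟩ := exists_bilinear_bound B hB₁ hB₂ N
    obtain ⟨K₁, C₁, hC₁, h₁⟩ := exists_supSeminorm_frameElt_le ι M
    obtain ⟨K₂, C₂, hC₂, h₂⟩ := exists_supSeminorm_frameElt_le κ M
    refine ⟨K₁ + K₂, C * C₁ * C₂, by positivity, fun i ↦ (h _ _).trans ?_⟩
    have := frameWeight_pos i
    have := frameWeight_pos i.inl
    have := frameWeight_pos i.inr
    grw [h₁, h₂, frameWeight_inl_le, frameWeight_inr_le]
    apply le_of_eq
    ring
  obtain ⟨Λ, hΛ⟩ := exists_continuousLinearMap_hasSum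
    (c := fun i ↦ (frameCoeff i).comp T.toLinearMap) (b := b) hr fun N ↦ by
    obtain ⟨K, C, hC, h⟩ := hb N
    obtain ⟨M, C', hC', h'⟩ := exists_frameCoeff_le (ι ⊕ κ) (K + r)
    obtain ⟨M', C'', hC'', h''⟩ := exists_le_supSeminorm
      ((supSeminorm _ ℂ M).comp T.toLinearMap) ((continuous_supSeminorm M).comp T.continuous)
    refine ⟨M', C * (C' * C''), fun i f ↦ ?_⟩
    have hi := frameWeight_pos i
    have h1 : supSeminorm _ ℂ M (T f) ≤ C'' * supSeminorm _ ℂ M' f := h'' f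
    rw [← div_eq_mul_inv, le_div_iff₀ (by positivity)]
    calc ‖frameCoeff i (T f)‖ * supSeminorm G ℂ N (b i) * frameWeight i ^ r
        ≤ ‖frameCoeff i (T f)‖ * (C * frameWeight i ^ K) * frameWeight i ^ r := by grw [h i]
      _ = C * (frameWeight i ^ (K + r) * ‖frameCoeff i (T f)‖) := by ring
      _ ≤ C * (C' * (C'' * supSeminorm _ ℂ M' f)) := by grw [h' i (T f), h1]
      _ = _ := by ring
  refine ⟨Λ, fun f ψ h hh ↦ ?_, fun Λ' hΛ' ↦ ?_⟩
  · have h1 : HasSum (fun p : FrameIndex ι × FrameIndex κ ↦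
        frameCoeff p.1 f • frameCoeff p.2 ψ • B (frameElt p.1) (frameElt p.2)) (Λ h) := by
      rw [← (frameIndexEquiv ι κ).hasSum_iff]
      refine (hΛ h).congr_fun fun i ↦ ?_
      rw [Function.comp_apply, frameIndexEquiv_apply, smul_smul, LinearMap.comp_apply]
      rw [← frameCoeff_sum i f ψ (T h) fun x ↦ hh _ _]
      rfl
    have h2 := h1.prod_fiberwise fun p ↦ (((hasSum_frame ψ).map (B (frameElt p))
      (hB₁ _)).congr_fun fun q ↦ (map_smul (B (frameElt p)) _ _).symm).const_smul (frameCoeff p f)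
    exact h2.unique (((hasSum_frame f).map (B.flip ψ) (hB₂ ψ)).congr_fun fun p ↦
      (map_smul (B.flip ψ) _ _).symm)
  · ext1 h
    have h1 : T' (T h) = h := by ext x; simp [T, T']
    have h2 := (hasSum_frame (T h)).map (Λ'.comp T') (Λ'.comp T').continuous
    rw [ContinuousLinearMap.comp_apply, h1] at h2
    refine h2.unique ((hΛ h).congr_fun fun i ↦ ?_)
    rw [Function.comp_apply, map_smul, ContinuousLinearMap.comp_apply,
      hΛ' (frameElt i.inl) (frameElt i.inr)]
    · rfl
    · intro x y
      exact frameElt_sum i _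

end Tensor

end SchwartzKernel

/-- A separately continuous bilinear map
`B : 𝓢(ℝⁿ) × 𝓢(ℝᵐ) → 𝓢(ℝᵏ)` extends uniquely to a continuous linear map
`F : 𝓢(ℝ^{n+m}) → 𝓢(ℝᵏ)` with `F (f ⊠ ψ) = B f ψ` on tensor products
(`f ⊠ ψ` being the Schwartz function `(x, y) ↦ f x * ψ y`). -/
theorem statement2 (n m k : ℕ)
    (B : SchwartzMap (Euc n) ℂ →ₗ[ℂ] SchwartzMap (Euc m) ℂ →ₗ[ℂ] SchwartzMap (Euc k) ℂ)
    (hB₁ : ∀ f : SchwartzMap (Euc n) ℂ, Continuous fun ψ : SchwartzMap (Euc m) ℂ => B f ψ)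
    (hB₂ : ∀ ψ : SchwartzMap (Euc m) ℂ, Continuous fun f : SchwartzMap (Euc n) ℂ => B f ψ) :
    ∃! F : SchwartzMap (Euc n × Euc m) ℂ →L[ℂ] SchwartzMap (Euc k) ℂ,
      ∀ (f : SchwartzMap (Euc n) ℂ) (ψ : SchwartzMap (Euc m) ℂ)
        (h : SchwartzMap (Euc n × Euc m) ℂ),
        (∀ (x : Euc n) (y : Euc m), h (x, y) = f x * ψ y) → F h = B f ψ :=
  SchwartzKernel.existsUnique_tensor_extension B hB₁ hB₂
end
end

section
/- Let n, k, m ∈ ℕ, let G : 𝓢(ℝ^{k+n}) → 𝓢(ℝ^m) be a continuous linear map, and let F : 𝓢(ℝ^n) → 𝓢(ℝ^{k+m}) be a linear map (not assumed continuous) such that for all h ∈ 𝓢(ℝ^n), g ∈ 𝓢(ℝ^k) and y ∈ ℝ^m one has G(g ⊠ h)(y) = ∫_{ℝ^k} F(h)(x,y) g(x) dx. Then F is continuous. -/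
noncomputable section

open MeasureTheory

open Filter Topology SchwartzMap
open scoped ContDiff LineDeriv Uniformity Convolution

section SchwartzSpace

variable {E₁ E₂ E : Type*} [NormedAddCommGroup E₁] [NormedSpace ℝ E₁]
  [NormedAddCommGroup E₂] [NormedSpace ℝ E₂] [NormedAddCommGroup E] [NormedSpace ℝ E]

lemma SchwartzMap.exists_tendsto_of_seminorm_sub_le (u : ℕ → 𝓢(E, ℂ))
    (hu : ∀ p l i j : ℕ, max p l ≤ i → i ≤ j →
      SchwartzMap.seminorm ℝ p l (u j - u i) ≤ (1 / 2) ^ i) :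
    ∃ f, Tendsto u atTop (𝓝 f) := by
  let d (i : ℕ) : 𝓢(E, ℂ) := u (i + 1) - u i
  have hsm : ∀ l : ℕ, (l : ℕ∞) ≤ ⊤ → Summable fun i => SchwartzMap.seminorm ℝ 0 l (d i) := by
    intro l _
    refine Summable.of_norm_bounded_eventually_nat summable_geometric_two ?_
    filter_upwards [eventually_ge_atTop l] with i hi
    rw [Real.norm_of_nonneg (apply_nonneg _ _)]
    exact hu 0 l i (i + 1) (by simpa using hi) (Nat.le_succ i)
  have hbd : ∀ (l i : ℕ) (x : E), (l : ℕ∞) ≤ ⊤ →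
      ‖iteratedFDeriv ℝ l (d i) x‖ ≤ SchwartzMap.seminorm ℝ 0 l (d i) := fun l i x _ =>
    SchwartzMap.norm_iteratedFDeriv_le_seminorm ℝ (d i) l x
  have hd : ∀ i, ContDiff ℝ ((⊤ : ℕ∞) : WithTop ℕ∞) (d i) := fun i => (d i).smooth ⊤
  let s : E → ℂ := fun x => ∑' i, d i x
  have hs : ContDiff ℝ ∞ s := contDiff_tsum hd hsm hbd
  let f : E → ℂ := fun x => u 0 x + s x
  have hf : ContDiff ℝ ∞ f := ((u 0).smooth ⊤).add hs
  have hlim : ∀ (l : ℕ) (x : E), Tendsto (fun j => iteratedFDeriv ℝ l (u j) x) atTop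
      (𝓝 (iteratedFDeriv ℝ l f x)) := by
    intro l x
    have h1 : iteratedFDeriv ℝ l f x = iteratedFDeriv ℝ l (u 0) x + iteratedFDeriv ℝ l s x :=
      iteratedFDeriv_add_apply ((u 0).contDiffAt l) (hs.contDiffAt.of_le (by exact_mod_cast le_top))
    have h2 : HasSum (fun i => iteratedFDeriv ℝ l (d i) x) (iteratedFDeriv ℝ l s x) := by
      rw [iteratedFDeriv_tsum_apply hd hsm hbd le_top]
      exact (Summable.of_norm_bounded (hsm l le_top) fun i => hbd l i x le_top).hasSum
    have h3 : ∀ j, iteratedFDeriv ℝ l (u j) x =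
        iteratedFDeriv ℝ l (u 0) x + ∑ i ∈ Finset.range j, iteratedFDeriv ℝ l (d i) x := by
      intro j
      have : ∀ i, iteratedFDeriv ℝ l (d i) x =
          iteratedFDeriv ℝ l (u (i + 1)) x - iteratedFDeriv ℝ l (u i) x := fun i =>
        iteratedFDeriv_sub_apply ((u (i + 1)).contDiffAt l) ((u i).contDiffAt l)
      rw [Finset.sum_congr rfl fun i _ => this i,
        Finset.sum_range_sub fun i => iteratedFDeriv ℝ l (u i) x]
      abel
    rw [h1, funext h3]
    exact h2.tendsto_sum_nat.const_add _
  have hle : ∀ (p l i : ℕ) (x : E), max p l ≤ i →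
      ‖x‖ ^ p * ‖iteratedFDeriv ℝ l f x - iteratedFDeriv ℝ l (u i) x‖ ≤ (1 / 2) ^ i := by
    intro p l i x hi
    refine le_of_tendsto ((((hlim l x).sub_const _).norm).const_mul _) ?_
    filter_upwards [eventually_ge_atTop i] with j hj
    rw [← iteratedFDeriv_sub_apply ((u j).contDiffAt l) ((u i).contDiffAt l)]
    exact (SchwartzMap.le_seminorm ℝ p l (u j - u i) x).trans (hu p l i j hi hj)
  let F : 𝓢(E, ℂ) :=
    { toFun := f
      smooth' := hf
      decay' p l := by
        refine ⟨(1 / 2) ^ (max p l) + SchwartzMap.seminorm ℝ p l (u (max p l)), fun x => ?_⟩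
        have h1 := hle p l _ x le_rfl
        have h2 := SchwartzMap.le_seminorm ℝ p l (u (max p l)) x
        have h3 := norm_sub_norm_le (iteratedFDeriv ℝ l f x) (iteratedFDeriv ℝ l (u (max p l)) x)
        have h4 := mul_le_mul_of_nonneg_left h3 (pow_nonneg (norm_nonneg x) p)
        rw [mul_sub] at h4
        linarith }
  refine ⟨F, ((schwartz_withSeminorms ℝ E ℂ).tendsto_nhds _ _).2 ?_⟩
  rintro ⟨p, l⟩ ε hε
  have h0 : ∀ᶠ i : ℕ in atTop, ((1 : ℝ) / 2) ^ i < ε :=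
    (tendsto_pow_atTop_nhds_zero_of_lt_one (by norm_num) (by norm_num)).eventually_lt_const hε
  filter_upwards [h0, eventually_ge_atTop (max p l)] with i hi hi'
  refine lt_of_le_of_lt ?_ hi
  rw [map_sub_rev]
  refine SchwartzMap.seminorm_le_bound ℝ p l _ (by positivity) fun x => ?_
  have : iteratedFDeriv ℝ l (F - u i) x = iteratedFDeriv ℝ l f x - iteratedFDeriv ℝ l (u i) x :=
    iteratedFDeriv_sub_apply (F.contDiffAt l) ((u i).contDiffAt l)
  change ‖x‖ ^ p * ‖iteratedFDeriv ℝ l (F - u i) x‖ ≤ _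
  rw [this]
  exact hle p l i x hi'

instance SchwartzMap.instIsCountablyGenerated : (𝓤 𝓢(E, ℂ)).IsCountablyGenerated :=
  IsUniformAddGroup.uniformity_countably_generated

instance SchwartzMap.instCompleteSpace : CompleteSpace 𝓢(E, ℂ) := by
  let U (N : ℕ) : Set (𝓢(E, ℂ) × 𝓢(E, ℂ)) :=
    {z | ∀ q ∈ Finset.Iic (N, N), schwartzSeminormFamily ℝ E ℂ q (z.2 - z.1) < (1 / 2) ^ N}
  refine UniformSpace.complete_of_convergent_controlled_sequences U (fun N => ?_) fun u hu => ?_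
  · rw [uniformity_eq_comap_nhds_zero]
    refine ⟨{f | ∀ q ∈ Finset.Iic (N, N), schwartzSeminormFamily ℝ E ℂ q f < (1 / 2) ^ N}, ?_,
      fun z hz => hz⟩
    refine (Filter.eventually_all_finset _).2 fun q _ => ?_
    have := ((schwartz_withSeminorms ℝ E ℂ).continuous_seminorm q).tendsto 0
    rw [map_zero] at this
    exact this.eventually_lt_const (by positivity)
  · refine SchwartzMap.exists_tendsto_of_seminorm_sub_le u fun p l i j hi hij => ?_
    exact (hu i i j le_rfl hij (p, l) (Finset.mem_Iic.2 (Prod.mk_le_mk.2 (max_le_iff.1 hi)))).le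

lemma norm_iteratedFDeriv_comp_le_of_norm_le_one {f : E₂ → ℂ} (hf : ContDiff ℝ ∞ f)
    (L : E₁ →L[ℝ] E₂) (hL : ‖L‖ ≤ 1) (l : ℕ) (x : E₁) :
    ‖iteratedFDeriv ℝ l (fun z => f (L z)) x‖ ≤ ‖iteratedFDeriv ℝ l f (L x)‖ := by
  have := L.iteratedFDeriv_comp_right hf x (i := l) (by exact_mod_cast le_top)
  change ‖iteratedFDeriv ℝ l (f ∘ L) x‖ ≤ _
  rw [this]
  refine (ContinuousMultilinearMap.norm_compContinuousLinearMap_le _ _).trans ?_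
  refine mul_le_of_le_one_right (norm_nonneg _) ?_
  exact Finset.prod_le_one (fun _ _ => norm_nonneg _) (fun _ _ => hL)

/-- The exterior product `h ↦ g ⊠ h` as a continuous linear map in `h`. -/
def extProdCLM (g : 𝓢(E₁, ℂ)) : 𝓢(E₂, ℂ) →L[ℂ] 𝓢(E₁ × E₂, ℂ) :=
  SchwartzMap.mkCLM (fun h z => g z.1 * h z.2)
    (fun f h x => by simp [mul_add])
    (fun a f x => by simp; ring)
    (fun f => ((g.smooth ⊤).comp contDiff_fst).mul ((f.smooth ⊤).comp contDiff_snd)) (by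
      rintro ⟨p, l⟩
      refine ⟨Finset.Iic (p, l), ∑ i ∈ Finset.range (l + 1), (l.choose i : ℝ) *
        (SchwartzMap.seminorm ℂ p i g + SchwartzMap.seminorm ℂ 0 i g),
        Finset.sum_nonneg fun i _ => by positivity, fun f z => ?_⟩
      have hsup : ∀ a b, a ≤ p → b ≤ l → SchwartzMap.seminorm ℂ a b f ≤
          (Finset.Iic (p, l)).sup (schwartzSeminormFamily ℂ E₂ ℂ) f := fun a b ha hb =>
        Seminorm.le_def.1 (Finset.le_sup (f := schwartzSeminormFamily ℂ E₂ ℂ) (b := (a, b))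
          (Finset.mem_Iic.2 (Prod.mk_le_mk.2 ⟨ha, hb⟩))) f
      set M := (Finset.Iic (p, l)).sup (schwartzSeminormFamily ℂ E₂ ℂ) f
      have hz : ‖z‖ ^ p ≤ ‖z.1‖ ^ p + ‖z.2‖ ^ p := by
        rw [Prod.norm_def]
        rcases max_cases ‖z.1‖ ‖z.2‖ with ⟨h, _⟩ | ⟨h, _⟩ <;> rw [h] <;>
          linarith [pow_nonneg (norm_nonneg z.1) p, pow_nonneg (norm_nonneg z.2) p]
      have hD := norm_iteratedFDeriv_mul_le (𝕜 := ℝ) (f := fun z : E₁ × E₂ => g z.1)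
        (g := fun z : E₁ × E₂ => f z.2) ((g.smooth ⊤).comp contDiff_fst)
        ((f.smooth ⊤).comp contDiff_snd) z (n := l) (by exact_mod_cast le_top)
      refine (mul_le_mul_of_nonneg_left hD (by positivity)).trans ?_
      rw [Finset.mul_sum, Finset.sum_mul]
      refine Finset.sum_le_sum fun i _ => ?_
      have h1 := norm_iteratedFDeriv_comp_le_of_norm_le_one (g.smooth ⊤)
        (ContinuousLinearMap.fst ℝ E₁ E₂) (ContinuousLinearMap.norm_fst_le ..) i z
      have h2 := norm_iteratedFDeriv_comp_le_of_norm_le_one (f.smooth ⊤)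
        (ContinuousLinearMap.snd ℝ E₁ E₂) (ContinuousLinearMap.norm_snd_le ..) (l - i) z
      simp only [ContinuousLinearMap.coe_fst', ContinuousLinearMap.coe_snd'] at h1 h2
      have g1 := SchwartzMap.le_seminorm ℂ p i g z.1
      have g2 := SchwartzMap.norm_iteratedFDeriv_le_seminorm ℂ g i z.1
      have f1 := (SchwartzMap.le_seminorm ℂ p (l - i) f z.2).trans
        (hsup _ _ le_rfl (Nat.sub_le _ _))
      have f2 := (SchwartzMap.norm_iteratedFDeriv_le_seminorm ℂ f (l - i) z.2).trans
        (hsup _ _ (Nat.zero_le _) (Nat.sub_le _ _))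
      calc _ ≤ (‖z.1‖ ^ p + ‖z.2‖ ^ p) * ((l.choose i : ℝ) * ‖iteratedFDeriv ℝ i g z.1‖ *
              ‖iteratedFDeriv ℝ (l - i) f z.2‖) := by gcongr
        _ = (l.choose i : ℝ) * ((‖z.1‖ ^ p * ‖iteratedFDeriv ℝ i g z.1‖) *
              ‖iteratedFDeriv ℝ (l - i) f z.2‖ + ‖iteratedFDeriv ℝ i g z.1‖ *
              (‖z.2‖ ^ p * ‖iteratedFDeriv ℝ (l - i) f z.2‖)) := by ring
        _ ≤ (l.choose i : ℝ) * (SchwartzMap.seminorm ℂ p i g * M +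
              SchwartzMap.seminorm ℂ 0 i g * M) := by gcongr
        _ = _ := by ring)

@[simp]
lemma extProdCLM_apply (g : 𝓢(E₁, ℂ)) (h : 𝓢(E₂, ℂ)) (z : E₁ × E₂) :
    extProdCLM g h z = g z.1 * h z.2 := rfl

/-- Evaluation at a point as a continuous linear functional on Schwartz functions. -/
def schwartzEvalCLM (x : E) : 𝓢(E, ℂ) →L[ℂ] ℂ :=
  (BoundedContinuousFunction.evalCLM ℂ x).comp (SchwartzMap.toBoundedContinuousFunctionCLM ℂ E ℂ)

@[simp]
lemma schwartzEvalCLM_apply (x : E) (f : 𝓢(E, ℂ)) : schwartzEvalCLM x f = f x := rfl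

section Barrelled

variable {V : Type*} [AddCommGroup V] [Module ℂ V] [UniformSpace V] [IsUniformAddGroup V]
  [ContinuousSMul ℂ V] [BarrelledSpace ℂ V]

lemma continuous_lineDerivOp_apply_of_pointwise (T : V →ₗ[ℂ] 𝓢(E, ℂ))
    (hT : ∀ x, Continuous fun v => T v x) (m x : E) : Continuous fun v => (∂_{m} (T v)) x := by
  let S (i : ℕ) : V →L[ℂ] ℂ :=
    { toFun v := ((i : ℝ) + 1) • (T v (x + ((i : ℝ) + 1)⁻¹ • m) - T v x)
      map_add' v w := by simp; ring
      map_smul' c v := by simp; ring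
      cont := by have := hT (x + ((i : ℝ) + 1)⁻¹ • m); have := hT x; fun_prop }
  have hlim : Tendsto (fun i v => S i v) atTop (𝓝 fun v => (∂_{m} (T v)) x) := by
    rw [tendsto_pi_nhds]
    intro v
    rw [SchwartzMap.lineDerivOp_apply]
    have h := ((T v).differentiableAt (x := x)).lineDifferentiableAt (v := m) |>.hasLineDerivAt
    have h0 : Tendsto (fun i : ℕ => ((i : ℝ) + 1)⁻¹) atTop (𝓝[≠] 0) := by
      refine tendsto_nhdsWithin_iff.2 ⟨?_, Eventually.of_forall fun i => ?_⟩
      · simpa using! tendsto_one_div_add_atTop_nhds_zero_nat (𝕜 := ℝ)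
      · exact inv_ne_zero (by positivity)
    have := h.tendsto_slope_zero.comp h0
    simpa [S, Function.comp_def] using! this
  exact (continuousLinearMapOfTendsto S hlim).continuous

lemma continuous_iteratedLineDerivOp_apply_of_pointwise (T : V →ₗ[ℂ] 𝓢(E, ℂ))
    (hT : ∀ x, Continuous fun v => T v x) {l : ℕ} (m : Fin l → E) (x : E) :
    Continuous fun v => (∂^{m} (T v)) x := by
  induction l generalizing T with
  | zero => simpa using hT x
  | succ l ih =>
    simp only [LineDeriv.iteratedLineDerivOp_succ_right]
    exact ih ((LineDeriv.lineDerivOpCLM ℂ 𝓢(E, ℂ) (m (Fin.last l))).toLinearMap ∘ₗ T)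
      (continuous_lineDerivOp_apply_of_pointwise T hT _) _

/-- A linear map from a barrelled space to a Schwartz space is continuous as soon as it is
continuous for the topology of pointwise convergence on the target. -/
theorem SchwartzMap.continuous_of_pointwise (T : V →ₗ[ℂ] 𝓢(E, ℂ))
    (hT : ∀ x, Continuous fun v => T v x) : Continuous T := by
  refine WithSeminorms.continuous_of_continuous_comp (schwartz_withSeminorms ℂ E ℂ) T ?_
  rintro ⟨p, l⟩
  refine Seminorm.continuous_of_lowerSemicontinuous _ ?_
  rw [lowerSemicontinuous_iff_isClosed_preimage]
  intro r
  rcases lt_or_ge r 0 with hr | hr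
  · convert isClosed_empty
    ext v
    simpa using hr.trans_le (apply_nonneg (SchwartzMap.seminorm ℂ p l) (T v))
  have key : ((schwartzSeminormFamily ℂ E ℂ (p, l)).comp T) ⁻¹' Set.Iic r =
      ⋂ (x : E) (m : Fin l → E),
        {v | ‖x‖ ^ p * ‖(∂^{m} (T v)) x‖ ≤ r * ∏ i, ‖m i‖} := by
    ext v
    simp only [Set.mem_preimage, Set.mem_Iic, Set.mem_iInter, Set.mem_ofPred_eq,
      Seminorm.comp_apply, schwartzSeminormFamily_apply, iteratedLineDerivOp_eq_iteratedFDeriv]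
    constructor
    · intro h x m
      calc _ ≤ ‖x‖ ^ p * (‖iteratedFDeriv ℝ l (T v) x‖ * ∏ i, ‖m i‖) := by
            gcongr; exact ContinuousMultilinearMap.le_opNorm _ _
        _ = (‖x‖ ^ p * ‖iteratedFDeriv ℝ l (T v) x‖) * ∏ i, ‖m i‖ := by ring
        _ ≤ _ := by gcongr; exact (SchwartzMap.le_seminorm ℂ p l (T v) x).trans h
    · intro h
      refine SchwartzMap.seminorm_le_bound ℂ p l _ hr fun x => ?_
      have : ‖(‖x‖ ^ p : ℝ) • iteratedFDeriv ℝ l (T v) x‖ ≤ r :=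
        ContinuousMultilinearMap.opNorm_le_bound hr fun m => by
          simpa [norm_smul] using! h x m
      simpa [norm_smul] using! this
  rw [key]
  exact isClosed_iInter fun x => isClosed_iInter fun m => isClosed_le
    ((continuous_iteratedLineDerivOp_apply_of_pointwise T hT m x).norm.const_mul _)
    continuous_const

end Barrelled

/-- Point evaluation is a pointwise limit of integrals against Schwartz functions. -/
lemma exists_schwartz_approx_dirac {H : Type*} [NormedAddCommGroup H] [InnerProductSpace ℝ H]
    [FiniteDimensional ℝ H] [MeasurableSpace H] [BorelSpace H] (μ : Measure H)
    [μ.IsAddHaarMeasure] (x₀ : H) :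
    ∃ g : ℕ → 𝓢(H, ℂ), ∀ u : H → ℂ, Continuous u →
      Tendsto (fun i => ∫ x, u x * g i x ∂μ) atTop (𝓝 (u x₀)) := by
  let φ (i : ℕ) : ContDiffBump (0 : H) :=
    { rIn := 1 / ((i : ℝ) + 1) / 2
      rOut := 1 / ((i : ℝ) + 1)
      rIn_pos := by positivity
      rIn_lt_rOut := half_lt_self (by positivity) }
  have hφ : Tendsto (fun i => (φ i).rOut) atTop (𝓝 0) := tendsto_one_div_add_atTop_nhds_zero_nat
  have hcs (i : ℕ) : HasCompactSupport fun t => (((φ i).normed μ (x₀ - t) : ℝ) : ℂ) :=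
    (((φ i).hasCompactSupport_normed (μ := μ)).comp_homeomorph (Homeomorph.subLeft x₀)).comp_left
      (g := ((↑) : ℝ → ℂ)) Complex.ofReal_zero
  have hcd (i : ℕ) : ContDiff ℝ ∞ fun t => (((φ i).normed μ (x₀ - t) : ℝ) : ℂ) :=
    Complex.ofRealCLM.contDiff.comp
      ((φ i).contDiff_normed.comp (contDiff_const.sub contDiff_id))
  refine ⟨fun i => (hcs i).toSchwartzMap (hcd i), fun u hu => ?_⟩
  refine (ContDiffBump.convolution_tendsto_right_of_continuous (μ := μ) hφ hu x₀).congr fun i => ?_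
  rw [convolution_eq_swap]
  refine integral_congr_ae (Eventually.of_forall fun t => ?_)
  simp [mul_comm]

end SchwartzSpace

/-- (Sufficient criterion for restriction.) Let
`G : 𝓢(ℝ^{k+n}) → 𝓢(ℝᵐ)` be continuous linear and let `F : 𝓢(ℝⁿ) → 𝓢(ℝ^{k+m})` be a linear
map (not assumed continuous) such that `G (g ⊠ h) (y) = ∫_{ℝᵏ} F h (x, y) g x dx` for all
test functions `h ∈ 𝓢(ℝⁿ)`, `g ∈ 𝓢(ℝᵏ)` and `y ∈ ℝᵐ` (here `g ⊠ h` is the Schwartz function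
`(x, y) ↦ g x * h y`).  Then `F` is continuous. -/
theorem statement3 (n k m : ℕ)
    (G : SchwartzMap (Euc k × Euc n) ℂ →L[ℂ] SchwartzMap (Euc m) ℂ)
    (F : SchwartzMap (Euc n) ℂ →ₗ[ℂ] SchwartzMap (Euc k × Euc m) ℂ)
    (hGF : ∀ (h : SchwartzMap (Euc n) ℂ) (g : SchwartzMap (Euc k) ℂ)
        (w : SchwartzMap (Euc k × Euc n) ℂ),
        (∀ (x : Euc k) (y : Euc n), w (x, y) = g x * h y) →
        ∀ y : Euc m, G w y = ∫ x : Euc k, F h (x, y) * g x) :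
    Continuous F := by
  refine SchwartzMap.continuous_of_pointwise F ?_
  rintro ⟨x₀, y⟩
  obtain ⟨g, hg⟩ := exists_schwartz_approx_dirac (volume : Measure (Euc k)) x₀
  have hlim : Tendsto (fun i h => ((schwartzEvalCLM y).comp (G.comp (extProdCLM (g i)))) h) atTop
      (𝓝 fun h => F h (x₀, y)) := by
    rw [tendsto_pi_nhds]
    intro h
    refine (hg (fun x => F h (x, y)) (by fun_prop)).congr fun i => ?_
    exact (hGF h (g i) (extProdCLM (g i) h) (fun _ _ => rfl) y).symm
  exact (continuousLinearMapOfTendsto _ hlim).continuous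
end
end

section
/- Let n, m, k ∈ ℕ and let F : 𝓢(ℝ^n) → 𝓢(ℝ^m) be a continuous linear map. Then there exists a unique continuous linear map E : 𝓢(ℝ^{k+n}) → 𝓢(ℝ^{k+m}) such that E(f ⊠ g) = f ⊠ F(g) for all f ∈ 𝓢(ℝ^k) and g ∈ 𝓢(ℝ^n); moreover E is given explicitly by E(h)(x,y) = F(z ↦ h(x,z))(y) for all h ∈ 𝓢(ℝ^{k+n}), x ∈ ℝ^k, y ∈ ℝ^m. -/
noncomputable section

open scoped SchwartzMap LineDeriv ContDiff Topology Convolution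
open Filter MeasureTheory

namespace SchwartzMap

section Shift

variable {W : Type*} [NormedAddCommGroup W] [NormedSpace ℝ W]

theorem lineDerivOp_comm (f : 𝓢(W, ℂ)) (a b : W) :
    (∂_{a} (∂_{b} f) : 𝓢(W, ℂ)) = ∂_{b} (∂_{a} f) := by
  have key (a b x : W) : (∂_{a} (∂_{b} f) : 𝓢(W, ℂ)) x = fderiv ℝ (fderiv ℝ f) x a b := by
    have hd : DifferentiableAt ℝ (fderiv ℝ f) x := (fderivCLM ℝ W ℂ f).differentiableAt
    have hf : ⇑(∂_{b} f : 𝓢(W, ℂ)) = fun y => fderiv ℝ f y b := rfl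
    rw [lineDerivOp_apply_eq_fderiv, hf, fderiv_clm_apply hd (differentiableAt_const b)]
    simp
  ext x
  rw [key, key]
  exact ((f.smooth 2).contDiffAt.isSymmSndFDerivAt (by simp)) a b

theorem lineDerivOp_iteratedLineDerivOp_comm (f : 𝓢(W, ℂ)) (a : W) {n : ℕ} (v : Fin n → W) :
    (∂_{a} (∂^{v} f) : 𝓢(W, ℂ)) = ∂^{v} (∂_{a} f) := by
  induction n with
  | zero => simp
  | succ n ih =>
    rw [LineDeriv.iteratedLineDerivOp_succ_left, LineDeriv.iteratedLineDerivOp_succ_left,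
      lineDerivOp_comm, ih]

theorem iteratedFDeriv_lineDerivOp (f : 𝓢(W, ℂ)) (a x : W) (n : ℕ) :
    iteratedFDeriv ℝ n (∂_{a} f : 𝓢(W, ℂ)) x = fderiv ℝ (iteratedFDeriv ℝ n f) x a := by
  ext v
  rw [← iteratedLineDerivOp_eq_iteratedFDeriv, ← lineDerivOp_iteratedLineDerivOp_comm]
  have h := iteratedFDeriv_succ_apply_left (𝕜 := ℝ) (f := f) (x := x) (n := n) (Fin.cons a v)
  simp only [Fin.cons_zero, Fin.tail_cons] at h
  rw [← h, ← iteratedLineDerivOp_eq_iteratedFDeriv, LineDeriv.iteratedLineDerivOp_succ_left]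
  simp

theorem one_add_norm_pow_mul_norm_add_sub_le {G : Type*} [NormedAddCommGroup G] [NormedSpace ℝ G]
    {g : W → G} (hg : Differentiable ℝ g) {m : ℕ} {C : ℝ}
    (hC : ∀ x, (1 + ‖x‖) ^ m * ‖fderiv ℝ g x‖ ≤ C) {a : W} (ha : ‖a‖ ≤ 1) (x : W) :
    (1 + ‖x‖) ^ m * ‖g (x + a) - g x‖ ≤ 2 ^ m * C * ‖a‖ := by
  have hx : 0 < (1 + ‖x‖) ^ m := by positivity
  have hseg : ∀ y ∈ Metric.closedBall x ‖a‖, ‖fderiv ℝ g y‖ ≤ 2 ^ m * C / (1 + ‖x‖) ^ m := by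
    intro y hy
    rw [le_div_iff₀ hx]
    have hxy : 1 + ‖x‖ ≤ 2 * (1 + ‖y‖) := by
      have h1 : ‖x‖ ≤ ‖y‖ + ‖y - x‖ := by
        have := norm_sub_le y (y - x)
        rwa [sub_sub_cancel] at this
      have h2 : ‖y - x‖ ≤ ‖a‖ := by simpa [dist_eq_norm] using hy
      have := norm_nonneg y
      linarith
    calc ‖fderiv ℝ g y‖ * (1 + ‖x‖) ^ m ≤ ‖fderiv ℝ g y‖ * (2 * (1 + ‖y‖)) ^ m := by gcongr
      _ = 2 ^ m * ((1 + ‖y‖) ^ m * ‖fderiv ℝ g y‖) := by rw [mul_pow]; ring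
      _ ≤ 2 ^ m * C := by gcongr; exact hC y
  have := Convex.norm_image_sub_le_of_norm_fderiv_le (𝕜 := ℝ) (fun y _ => hg y) hseg
    (convex_closedBall x ‖a‖) (Metric.mem_closedBall_self (norm_nonneg a))
    (show x + a ∈ Metric.closedBall x ‖a‖ by simp)
  rw [add_sub_cancel_left] at this
  calc _ ≤ (1 + ‖x‖) ^ m * (2 ^ m * C / (1 + ‖x‖) ^ m * ‖a‖) := by gcongr
    _ = _ := by field_simp

/-- The translate `x ↦ f (x + a)` of a Schwartz function. -/
def shift (a : W) : 𝓢(W, ℂ) →L[ℂ] 𝓢(W, ℂ) := compSubConstCLM ℂ (-a)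

@[simp]
theorem shift_apply (a : W) (f : 𝓢(W, ℂ)) (x : W) : shift a f x = f (x + a) := by
  simp [shift]

theorem shift_add (a b : W) (f : 𝓢(W, ℂ)) : shift (a + b) f = shift a (shift b f) := by
  ext x
  simp [add_assoc]

theorem iteratedFDeriv_shift (a : W) (f : 𝓢(W, ℂ)) (n : ℕ) (x : W) :
    iteratedFDeriv ℝ n (shift a f) x = iteratedFDeriv ℝ n f (x + a) := by
  have : ⇑(shift a f) = fun y => f (y + a) := by ext; simp
  rw [this, iteratedFDeriv_comp_add_right]

theorem differentiable_iteratedFDeriv (f : 𝓢(W, ℂ)) (n : ℕ) :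
    Differentiable ℝ (iteratedFDeriv ℝ n f) :=
  (f.smooth (n + 1 : ℕ)).differentiable_iteratedFDeriv (by exact_mod_cast Nat.lt_succ_self n)

theorem iteratedFDeriv_add_sub_fderiv_le (f : 𝓢(W, ℂ)) (m n : ℕ) : ∃ C, ∀ a : W, ‖a‖ ≤ 1 → ∀ x,
    ‖x‖ ^ m * ‖iteratedFDeriv ℝ n f (x + a) - iteratedFDeriv ℝ n f x
      - fderiv ℝ (iteratedFDeriv ℝ n f) x a‖ ≤ C * ‖a‖ ^ 2 := by
  obtain ⟨C, hC⟩ : ∃ C, ∀ x, (1 + ‖x‖) ^ m * ‖iteratedFDeriv ℝ (n + 1 + 1) f x‖ ≤ C :=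
    ⟨_, fun x => one_add_le_sup_seminorm_apply (𝕜 := ℝ) (m := (m, n + 1 + 1)) le_rfl le_rfl f x⟩
  have h1 {a : W} (ha : ‖a‖ ≤ 1) (x : W) :
      (1 + ‖x‖) ^ m * ‖fderiv ℝ (iteratedFDeriv ℝ n f) (x + a)
        - fderiv ℝ (iteratedFDeriv ℝ n f) x‖ ≤ 2 ^ m * C * ‖a‖ := by
    have e : ‖fderiv ℝ (iteratedFDeriv ℝ n f) (x + a) - fderiv ℝ (iteratedFDeriv ℝ n f) x‖
        = ‖iteratedFDeriv ℝ (n + 1) f (x + a) - iteratedFDeriv ℝ (n + 1) f x‖ := by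
      rw [fderiv_iteratedFDeriv, ← dist_eq_norm (iteratedFDeriv ℝ (n + 1) f (x + a))]
      exact (dist_eq_norm _ _).symm.trans ((continuousMultilinearCurryLeftEquiv ℝ
        (fun _ : Fin (n + 1) => W) ℂ).dist_map _ _)
    rw [e]
    refine one_add_norm_pow_mul_norm_add_sub_le (f.differentiable_iteratedFDeriv (n + 1))
      (fun x => ?_) ha x
    rw [norm_fderiv_iteratedFDeriv]
    exact hC x
  have hC0 : 0 ≤ C := le_trans (by positivity) (hC 0)
  refine ⟨2 ^ m * C, fun a ha x => ?_⟩
  have hx : 0 < (1 + ‖x‖) ^ m := by positivity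
  have hb : ∀ y ∈ Metric.closedBall x ‖a‖, ‖fderiv ℝ (iteratedFDeriv ℝ n f) y
      - fderiv ℝ (iteratedFDeriv ℝ n f) x‖ ≤ 2 ^ m * C * ‖a‖ / (1 + ‖x‖) ^ m := by
    intro y hy
    have h2 : ‖y - x‖ ≤ ‖a‖ := by simpa [dist_eq_norm] using hy
    have := h1 (h2.trans ha) x
    rw [add_sub_cancel] at this
    rw [le_div_iff₀ hx, mul_comm]
    exact this.trans (by gcongr)
  have := Convex.norm_image_sub_le_of_norm_fderiv_le' (𝕜 := ℝ)
    (fun y _ => f.differentiable_iteratedFDeriv n y) hb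
    (convex_closedBall x ‖a‖) (Metric.mem_closedBall_self (norm_nonneg a))
    (show x + a ∈ Metric.closedBall x ‖a‖ by simp)
  rw [add_sub_cancel_left] at this
  calc _ ≤ (1 + ‖x‖) ^ m * (2 ^ m * C * ‖a‖ / (1 + ‖x‖) ^ m * ‖a‖) := by
        gcongr
        linarith [norm_nonneg x]
    _ = _ := by field_simp

theorem seminorm_shift_sub_sub_lineDerivOp_le (f : 𝓢(W, ℂ)) (m n : ℕ) : ∃ C, ∀ a : W, ‖a‖ ≤ 1 →
    SchwartzMap.seminorm ℂ m n (shift a f - f - ∂_{a} f) ≤ C * ‖a‖ ^ 2 := by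
  obtain ⟨C, hC⟩ := f.iteratedFDeriv_add_sub_fderiv_le m n
  refine ⟨C, fun a ha => seminorm_le_bound ℂ m n _ (le_trans (by positivity) (hC a ha 0)) ?_⟩
  intro x
  have h : iteratedFDeriv ℝ n (shift a f - f - ∂_{a} f : 𝓢(W, ℂ)) x =
      iteratedFDeriv ℝ n f (x + a) - iteratedFDeriv ℝ n f x
      - fderiv ℝ (iteratedFDeriv ℝ n f) x a := by
    rw [← iteratedFDeriv_lineDerivOp, ← iteratedFDeriv_shift]
    have h1 : ⇑(shift a f - f - ∂_{a} f : 𝓢(W, ℂ))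
      = (⇑(shift a f) - ⇑f) - ⇑(∂_{a} f : 𝓢(W, ℂ)) := by ext; simp
    have hs (g : 𝓢(W, ℂ)) : ContDiffAt ℝ n g x := (g.smooth n).contDiffAt
    rw [h1, iteratedFDeriv_sub_apply (f := ⇑(shift a f) - ⇑f) ((hs _).sub (hs _)) (hs _),
      iteratedFDeriv_sub_apply (hs _) (hs _)]
  rw [h]
  exact hC a ha x

theorem seminorm_lineDerivOp_le (f : 𝓢(W, ℂ)) (m n : ℕ) (a : W) :
    SchwartzMap.seminorm ℂ m n (∂_{a} f) ≤ SchwartzMap.seminorm ℂ m (n + 1) f * ‖a‖ := by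
  refine seminorm_le_bound ℂ m n _ (by positivity) fun x => ?_
  rw [iteratedFDeriv_lineDerivOp]
  calc _ ≤ ‖x‖ ^ m * (‖fderiv ℝ (iteratedFDeriv ℝ n f) x‖ * ‖a‖) := by
        gcongr; exact ContinuousLinearMap.le_opNorm _ _
    _ = (‖x‖ ^ m * ‖iteratedFDeriv ℝ (n + 1) f x‖) * ‖a‖ := by
        rw [norm_fderiv_iteratedFDeriv]; ring
    _ ≤ _ := by gcongr; exact f.le_seminorm ℂ m (n + 1) x

theorem continuous_shift (f : 𝓢(W, ℂ)) : Continuous fun a : W => shift a f := by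
  have h0 (f : 𝓢(W, ℂ)) : Tendsto (fun a : W => shift a f) (𝓝 0) (𝓝 f) := by
    rw [(schwartz_withSeminorms ℂ W ℂ).tendsto_nhds]
    rintro ⟨m, n⟩ ε hε
    obtain ⟨C, hC⟩ := f.seminorm_shift_sub_sub_lineDerivOp_le m n
    have ht : Tendsto (fun a : W => C * ‖a‖ ^ 2 + SchwartzMap.seminorm ℂ m (n + 1) f * ‖a‖)
        (𝓝 0) (𝓝 0) := by
      have : Continuous fun a : W =>
        C * ‖a‖ ^ 2 + SchwartzMap.seminorm ℂ m (n + 1) f * ‖a‖ := by fun_prop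
      simpa using this.tendsto 0
    filter_upwards [ht.eventually_lt_const hε, Metric.closedBall_mem_nhds (0 : W) one_pos]
      with a ha ha1
    refine lt_of_le_of_lt ?_ ha
    rw [schwartzSeminormFamily_apply, ← sub_add_cancel (shift a f - f) (∂_{a} f)]
    exact (map_add_le_add _ _ _).trans
      (add_le_add (hC a (by simpa using ha1)) (f.seminorm_lineDerivOp_le m n a))
  refine continuous_iff_continuousAt.2 fun a => ?_
  have h1 : Tendsto (fun b : W => b - a) (𝓝 a) (𝓝 0) := by
    have : Continuous fun b : W => b - a := by fun_prop
    simpa using this.tendsto a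
  have := (h0 (shift a f)).comp h1
  refine this.congr fun b => ?_
  simp [← shift_add]

theorem isLittleO_clm_shift (T : 𝓢(W, ℂ) →L[ℂ] ℂ) (f : 𝓢(W, ℂ)) (a₀ : W) :
    (fun a => T (shift (a₀ + a) f) - T (shift a₀ f) - T (shift a₀ (∂_{a} f)))
      =o[𝓝 0] fun a : W => a := by
  have hT : Continuous (T.comp (shift a₀)) := (T.comp (shift a₀)).continuous
  obtain ⟨s, C, -, hC⟩ := Seminorm.bound_of_continuous (schwartz_withSeminorms ℂ W ℂ)
    ((normSeminorm ℂ ℂ).comp (T.comp (shift a₀)).toLinearMap) (continuous_norm.comp hT)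
  choose D hD using f.seminorm_shift_sub_sub_lineDerivOp_le
  set K : ℝ := ∑ i ∈ s, |D i.1 i.2| with hK
  refine Asymptotics.IsBigO.trans_isLittleO (g := fun a : W => ‖a‖ ^ 2) ?_ ?_
  · refine Asymptotics.IsBigO.of_bound (C * K) ?_
    filter_upwards [Metric.closedBall_mem_nhds (0 : W) one_pos] with a ha1
    have ha : ‖a‖ ≤ 1 := by simpa using ha1
    have h1 : T (shift (a₀ + a) f) - T (shift a₀ f) - T (shift a₀ (∂_{a} f))
        = (T.comp (shift a₀)) (shift a f - f - ∂_{a} f) := by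
      rw [shift_add]; simp
    rw [h1]
    refine (hC _).trans ?_
    rw [smul_apply, NNReal.smul_def, smul_eq_mul, mul_assoc]
    gcongr
    refine Seminorm.finset_sup_apply_le (by positivity) fun i hi => ?_
    refine (hD i.1 i.2 a ha).trans ?_
    rw [Real.norm_of_nonneg (by positivity)]
    gcongr
    exact (le_abs_self _).trans
      (Finset.single_le_sum (f := fun i : ℕ × ℕ => |D i.1 i.2|) (fun _ _ => abs_nonneg _) hi)
  · simpa using Asymptotics.isLittleO_norm_pow_id (E' := W) one_lt_two

theorem hasFDerivAt_clm_shift {U : Type*} [NormedAddCommGroup U] [NormedSpace ℝ U]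
    (ι : U →L[ℝ] W) (T : 𝓢(W, ℂ) →L[ℂ] ℂ) (f : 𝓢(W, ℂ)) (a₀ : U) (L : U →L[ℝ] ℂ)
    (hL : ∀ a, L a = T (shift (ι a₀) (∂_{ι a} f))) :
    HasFDerivAt (fun a => T (shift (ι a) f)) L a₀ := by
  rw [hasFDerivAt_iff_isLittleO_nhds_zero]
  have h := (isLittleO_clm_shift T f (ι a₀)).comp_tendsto (ι.continuous.tendsto' 0 0 (map_zero ι))
  refine (h.trans_isBigO (ι.isBigO_id _)).congr_left fun a => ?_
  simp [hL]

end Shift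

theorem _root_.norm_prod_pow_le {A B : Type*} [SeminormedAddCommGroup A]
    [SeminormedAddCommGroup B] (x : A) (y : B) (m : ℕ) :
    ‖(x, y)‖ ^ m ≤ ‖x‖ ^ m + ‖y‖ ^ m := by
  rcases le_total ‖x‖ ‖y‖ with hxy | hxy
  · rw [Prod.norm_mk, max_eq_right hxy]
    exact le_add_of_nonneg_left (by positivity)
  · rw [Prod.norm_mk, max_eq_left hxy]
    exact le_add_of_nonneg_right (by positivity)

section Slice

variable {A B : Type*} [NormedAddCommGroup A] [NormedSpace ℝ A]
  [NormedAddCommGroup B] [NormedSpace ℝ B]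

theorem norm_iteratedFDeriv_comp_le_of_norm_le_one {V W : Type*} [NormedAddCommGroup V]
    [NormedSpace ℝ V] [NormedAddCommGroup W] [NormedSpace ℝ W] {g : V →L[ℝ] W} (hg : ‖g‖ ≤ 1)
    (f : 𝓢(W, ℂ)) (j : ℕ) (u : V) :
    ‖iteratedFDeriv ℝ j (fun v => f (g v)) u‖ ≤ ‖iteratedFDeriv ℝ j f (g u)‖ := by
  rw [show (fun v => f (g v)) = f ∘ g from rfl,
    ContinuousLinearMap.iteratedFDeriv_comp_right _ (f.smooth j) u le_rfl]
  refine (ContinuousMultilinearMap.norm_compContinuousLinearMap_le _ _).trans ?_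
  have h1 : ∏ _i : Fin j, ‖g‖ ≤ 1 := Finset.prod_le_one (fun _ _ => norm_nonneg _) fun _ _ => hg
  simpa using mul_le_mul_of_nonneg_left h1 (norm_nonneg _)

/-- The partial function `z ↦ h (x, z)` of a Schwartz function of two variables. -/
def slice (x : A) : 𝓢(A × B, ℂ) →L[ℂ] 𝓢(B, ℂ) :=
  (compCLMOfAntilipschitz (K := 1) ℂ (ContinuousLinearMap.inr ℝ A B).hasTemperateGrowth
    (AntilipschitzWith.of_le_mul_dist fun _ _ => by simp [Prod.dist_eq])) ∘L shift (x, 0)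

@[simp]
theorem slice_apply (x : A) (h : 𝓢(A × B, ℂ)) (z : B) : slice x h z = h (x, z) := by
  rw [slice, ContinuousLinearMap.comp_apply, compCLMOfAntilipschitz_apply]
  simp

theorem slice_add (x a : A) (h : 𝓢(A × B, ℂ)) : slice (x + a) h = slice x (shift (a, 0) h) := by
  ext z
  simp

theorem continuous_slice (h : 𝓢(A × B, ℂ)) : Continuous fun x : A => slice x h := by
  have := (ContinuousLinearMap.continuous (slice (B := B) (0 : A))).comp
    ((continuous_shift h).comp (by fun_prop : Continuous fun x : A => (x, (0 : B))))
  exact this.congr fun x => by simp [← slice_add]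

theorem norm_iteratedFDeriv_slice_le (x : A) (h : 𝓢(A × B, ℂ)) (j : ℕ) (z : B) :
    ‖iteratedFDeriv ℝ j (slice x h) z‖ ≤ ‖iteratedFDeriv ℝ j h (x, z)‖ := by
  have e : ⇑(slice x h) = fun z => shift (x, 0) h (ContinuousLinearMap.inr ℝ A B z) := by
    ext; simp
  rw [e]
  refine (norm_iteratedFDeriv_comp_le_of_norm_le_one
    (ContinuousLinearMap.norm_inr_le_one ℝ A B) _ j z).trans_eq ?_
  rw [iteratedFDeriv_shift]
  simp

variable {𝕜 : Type*} [RCLike 𝕜] [NormedSpace 𝕜 ℂ] [SMulCommClass ℝ 𝕜 ℂ]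

theorem norm_pow_mul_seminorm_slice_le (h : 𝓢(A × B, ℂ)) (l i j : ℕ) (x : A) :
    ‖x‖ ^ l * SchwartzMap.seminorm 𝕜 i j (slice x h) ≤ SchwartzMap.seminorm 𝕜 (l + i) j h := by
  rcases (pow_nonneg (norm_nonneg x) l).eq_or_lt with h0 | h0
  · rw [← h0, zero_mul]
    positivity
  rw [← le_div_iff₀' h0]
  refine seminorm_le_bound 𝕜 i j _ (by positivity) fun z => ?_
  rw [le_div_iff₀' h0]
  calc ‖x‖ ^ l * (‖z‖ ^ i * ‖iteratedFDeriv ℝ j (slice x h) z‖)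
      ≤ ‖(x, z)‖ ^ l * (‖(x, z)‖ ^ i * ‖iteratedFDeriv ℝ j h (x, z)‖) := by
        gcongr
        · exact le_max_left _ _
        · exact le_max_right _ _
        · exact norm_iteratedFDeriv_slice_le x h j z
    _ = ‖(x, z)‖ ^ (l + i) * ‖iteratedFDeriv ℝ j h (x, z)‖ := by ring
    _ ≤ _ := h.le_seminorm 𝕜 (l + i) j _

theorem exists_norm_pow_mul_slice_le {q : Seminorm 𝕜 𝓢(B, ℂ)} (hq : Continuous q) (l : ℕ) :
    ∃ p : Seminorm 𝕜 𝓢(A × B, ℂ), Continuous p ∧ ∀ h x, ‖x‖ ^ l * q (slice x h) ≤ p h := by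
  obtain ⟨s, C, -, hC⟩ := Seminorm.bound_of_continuous (schwartz_withSeminorms 𝕜 B ℂ) q hq
  refine ⟨C • ∑ i ∈ s, schwartzSeminormFamily 𝕜 (A × B) ℂ (l + i.1, i.2), ?_, fun h x => ?_⟩
  · have : Continuous fun h : 𝓢(A × B, ℂ) =>
        (C : ℝ) * ∑ i ∈ s, schwartzSeminormFamily 𝕜 (A × B) ℂ (l + i.1, i.2) h :=
      continuous_const.mul (continuous_finsetSum _ fun i _ =>
        (schwartz_withSeminorms 𝕜 (A × B) ℂ).continuous_seminorm _)
    exact this.congr fun h => by rw [smul_apply, sum_apply]; rfl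
  calc ‖x‖ ^ l * q (slice x h)
      ≤ ‖x‖ ^ l * ((C • ∑ i ∈ s, schwartzSeminormFamily 𝕜 B ℂ i) (slice x h)) := by
        gcongr
        exact (hC _).trans (mul_le_mul_of_nonneg_left
          (Seminorm.finset_sup_le_sum _ _ _) C.2)
    _ ≤ _ := by
        simp only [smul_apply, sum_apply, schwartzSeminormFamily_apply]
        rw [mul_smul_comm, Finset.mul_sum]
        gcongr
        exact norm_pow_mul_seminorm_slice_le h l _ _ x

end Slice

section Augment

variable {A B C : Type*} [NormedAddCommGroup A] [NormedSpace ℝ A]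
  [NormedAddCommGroup B] [NormedSpace ℝ B] [NormedAddCommGroup C] [NormedSpace ℝ C]

/-- The function `(x, y) ↦ F (z ↦ h (x, z)) y`. -/
def augmentFun (F : 𝓢(B, ℂ) →L[ℂ] 𝓢(C, ℂ)) (h : 𝓢(A × B, ℂ)) (u : A × C) : ℂ :=
  F (slice u.1 h) u.2

theorem continuous_augmentFun (F : 𝓢(B, ℂ) →L[ℂ] 𝓢(C, ℂ)) (h : 𝓢(A × B, ℂ)) :
    Continuous (augmentFun F h) := by
  have h1 : Continuous fun u : A × C =>
      toBoundedContinuousFunctionCLM ℂ C ℂ (F (slice u.1 h)) :=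
    (ContinuousLinearMap.continuous _).comp
      (F.continuous.comp ((continuous_slice h).comp continuous_fst))
  exact h1.eval continuous_snd

theorem _root_.Module.Basis.sum_coord_smulRight {ι V : Type*} [Fintype ι] [NormedAddCommGroup V]
    [NormedSpace ℝ V] [FiniteDimensional ℝ V] (b : Module.Basis ι ℝ V) (L : V →L[ℝ] ℂ) :
    ∑ i, (LinearMap.toContinuousLinearMap (b.coord i)).smulRight (L (b i)) = L := by
  ext v
  have := congrArg L (b.sum_repr v)
  rw [map_sum] at this
  simp only [map_smul] at this
  rw [sum_apply, ← this]
  rfl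

variable [FiniteDimensional ℝ A] [FiniteDimensional ℝ C]

theorem hasFDerivAt_augmentFun {ι κ : Type*} [Fintype ι] [Fintype κ]
    (bA : Module.Basis ι ℝ A) (bC : Module.Basis κ ℝ C)
    (F : 𝓢(B, ℂ) →L[ℂ] 𝓢(C, ℂ)) (h : 𝓢(A × B, ℂ)) (u : A × C) :
    HasFDerivAt (augmentFun F h)
      ((∑ i, (LinearMap.toContinuousLinearMap (bA.coord i)).smulRight
          (augmentFun F (∂_{(bA i, (0 : B))} h) u)).coprod
        (∑ j, (LinearMap.toContinuousLinearMap (bC.coord j)).smulRight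
          (augmentFun (LineDeriv.lineDerivOpCLM ℂ 𝓢(C, ℂ) (bC j) ∘L F) h u))) u := by
  refine (hasStrictFDerivAt_uncurry_coprod (𝕜 := ℝ) (u := u)
    (f := fun x y => augmentFun F h (x, y))
    (f₁ := fun x y => ∑ i, (LinearMap.toContinuousLinearMap (bA.coord i)).smulRight
          (augmentFun F (∂_{(bA i, (0 : B))} h) (x, y)))
    (f₂ := fun x y => ∑ j, (LinearMap.toContinuousLinearMap (bC.coord j)).smulRight
          (augmentFun (LineDeriv.lineDerivOpCLM ℂ 𝓢(C, ℂ) (bC j) ∘L F) h (x, y)))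
    (Eventually.of_forall fun v => ?_) (Eventually.of_forall fun v => ?_) ?_ ?_).hasFDerivAt
  · let T : 𝓢(A × B, ℂ) →L[ℂ] ℂ := (BoundedContinuousFunction.evalCLM ℂ v.2) ∘L
      toBoundedContinuousFunctionCLM ℂ C ℂ ∘L F ∘L slice 0
    have hT (x : A) (g : 𝓢(A × B, ℂ)) : T (shift (x, 0) g) = augmentFun F g (x, v.2) := by
      have : slice x g = slice 0 (shift (x, 0) g) := by rw [← slice_add, zero_add]
      rw [augmentFun, this]
      rfl
    refine (hasFDerivAt_clm_shift (ContinuousLinearMap.inl ℝ A B) T h v.1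
      (∑ i, (LinearMap.toContinuousLinearMap (bA.coord i)).smulRight
        (augmentFun F (∂_{(bA i, (0 : B))} h) v)) fun a => ?_).congr_of_eventuallyEq
      (Eventually.of_forall fun x => (hT x h).symm)
    rw [ContinuousLinearMap.inl_apply, ContinuousLinearMap.inl_apply, hT]
    let S : A →ₗ[ℝ] ℂ :=
      { toFun := fun a => T (shift (v.1, 0) (∂_{(a, (0 : B))} h))
        map_add' := fun a b => by
          rw [← map_add, ← map_add, ← LineDeriv.lineDerivOp_left_add, Prod.mk_add_mk, add_zero]
        map_smul' := fun r a => by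
          have : ((r • a, 0) : A × B) = r • (a, 0) := by simp
          rw [this, LineDeriv.lineDerivOp_left_smul, ContinuousLinearMap.map_smul_of_tower,
            ContinuousLinearMap.map_smul_of_tower, RingHom.id_apply] }
    have hS : ∀ a, S a = augmentFun F (∂_{(a, (0 : B))} h) v := fun a => hT _ _
    simp only [← hS]
    exact congrArg (fun L : A →L[ℝ] ℂ => L a)
      (bA.sum_coord_smulRight (LinearMap.toContinuousLinearMap S))
  · have h1 := ((F (slice v.1 h)).differentiableAt (x := v.2)).hasFDerivAt
    rw [← bC.sum_coord_smulRight (fderiv ℝ _ v.2)] at h1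
    exact h1
  · refine Continuous.continuousAt (continuous_finsetSum _ fun i _ => ?_)
    exact (ContinuousLinearMap.smulRightL ℝ A ℂ _).continuous.comp (continuous_augmentFun _ _)
  · refine Continuous.continuousAt (continuous_finsetSum _ fun i _ => ?_)
    exact (ContinuousLinearMap.smulRightL ℝ C ℂ _).continuous.comp (continuous_augmentFun _ _)

theorem exists_hasFDerivAt_augmentFun (F : 𝓢(B, ℂ) →L[ℂ] 𝓢(C, ℂ)) :
    ∃ (σ : Type) (_ : Fintype σ) (L : σ → ℂ →L[ℝ] (A × C →L[ℝ] ℂ))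
      (F' : σ → 𝓢(B, ℂ) →L[ℂ] 𝓢(C, ℂ)) (P : σ → 𝓢(A × B, ℂ) →L[ℂ] 𝓢(A × B, ℂ)),
      ∀ h u, HasFDerivAt (augmentFun F h) (∑ s, L s (augmentFun (F' s) (P s h) u)) u := by
  let bA := Module.finBasis ℝ A
  let bC := Module.finBasis ℝ C
  refine ⟨Fin (Module.finrank ℝ A) ⊕ Fin (Module.finrank ℝ C), inferInstance,
    Sum.elim
      (fun i => ContinuousLinearMap.smulRightL ℝ (A × C) ℂ
        (LinearMap.toContinuousLinearMap (bA.coord i) ∘L ContinuousLinearMap.fst ℝ A C))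
      (fun j => ContinuousLinearMap.smulRightL ℝ (A × C) ℂ
        (LinearMap.toContinuousLinearMap (bC.coord j) ∘L ContinuousLinearMap.snd ℝ A C)),
    Sum.elim (fun _ => F) (fun j => LineDeriv.lineDerivOpCLM ℂ 𝓢(C, ℂ) (bC j) ∘L F),
    Sum.elim (fun i => LineDeriv.lineDerivOpCLM ℂ 𝓢(A × B, ℂ) (bA i, (0 : B)))
      (fun _ => ContinuousLinearMap.id ℂ _), fun h u => ?_⟩
  convert hasFDerivAt_augmentFun bA bC F h u using 1
  ext v <;> simp

theorem _root_.norm_iteratedFDeriv_succ_le_sum {V σ : Type*} [NormedAddCommGroup V]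
    [NormedSpace ℝ V] [Fintype σ] {g : V → ℂ} (L : σ → ℂ →L[ℝ] (V →L[ℝ] ℂ)) {G : σ → V → ℂ}
    (hG : ∀ s, ContDiff ℝ ∞ (G s)) (hg : ∀ u, HasFDerivAt g (∑ s, L s (G s u)) u) (j : ℕ) (u : V) :
    ‖iteratedFDeriv ℝ (j + 1) g u‖ ≤ ∑ s, ‖L s‖ * ‖iteratedFDeriv ℝ j (G s) u‖ := by
  have e : fderiv ℝ g = fun u => ∑ s, (L s ∘ G s) u := funext fun u => (hg u).fderiv
  have hG' (s : σ) : ContDiff ℝ j (G s) := (hG s).of_le (by exact_mod_cast le_top)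
  rw [← norm_iteratedFDeriv_fderiv, e, iteratedFDeriv_fun_sum_apply
    fun s _ => ((L s).contDiff.comp (hG' s)).contDiffAt]
  refine (norm_sum_le _ _).trans (Finset.sum_le_sum fun s _ => ?_)
  exact (L s).norm_iteratedFDeriv_comp_left (hG' s).contDiffAt le_rfl

theorem contDiff_augmentFun (F : 𝓢(B, ℂ) →L[ℂ] 𝓢(C, ℂ)) (h : 𝓢(A × B, ℂ)) :
    ContDiff ℝ ∞ (augmentFun F h) := by
  rw [contDiff_infty]
  intro j
  induction j generalizing F h with
  | zero => exact contDiff_zero.2 (continuous_augmentFun F h)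
  | succ j ih =>
    obtain ⟨σ, _, L, F', P, hL⟩ := exists_hasFDerivAt_augmentFun (A := A) F
    push_cast
    rw [contDiff_succ_iff_fderiv]
    refine ⟨fun u => (hL h u).differentiableAt, by simp, ?_⟩
    rw [show fderiv ℝ (augmentFun F h) = _ from funext fun u => (hL h u).fderiv]
    exact ContDiff.sum fun s _ => (L s).contDiff.comp (ih _ _)

theorem exists_norm_pow_mul_iteratedFDeriv_augmentFun_le (F : 𝓢(B, ℂ) →L[ℂ] 𝓢(C, ℂ)) (m j : ℕ) :
    ∃ q : Seminorm ℂ 𝓢(A × B, ℂ), Continuous q ∧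
      ∀ h u, ‖u‖ ^ m * ‖iteratedFDeriv ℝ j (augmentFun F h) u‖ ≤ q h := by
  induction j generalizing F with
  | zero =>
    have hc (i : ℕ) : Continuous ((SchwartzMap.seminorm ℂ i 0).comp F.toLinearMap) :=
      ((schwartz_withSeminorms ℂ C ℂ).continuous_seminorm (i, 0)).comp F.continuous
    obtain ⟨p, hp, hp'⟩ := exists_norm_pow_mul_slice_le (A := A) (hc 0) m
    obtain ⟨q, hq, hq'⟩ := exists_norm_pow_mul_slice_le (A := A) (hc m) 0
    refine ⟨p + q, hp.add hq, fun h ⟨x, y⟩ => ?_⟩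
    rw [norm_iteratedFDeriv_zero, augmentFun]
    have h1 := (F (slice x h)).norm_le_seminorm ℂ y
    have h2 := (F (slice x h)).norm_pow_mul_le_seminorm ℂ m y
    have h3 := hp' h x
    have h4 := hq' h x
    rw [pow_zero, one_mul] at h4
    have h5 := norm_prod_pow_le x y m
    calc _ ≤ (‖x‖ ^ m + ‖y‖ ^ m) * ‖F (slice x h) y‖ := by gcongr
      _ = ‖x‖ ^ m * ‖F (slice x h) y‖ + ‖y‖ ^ m * ‖F (slice x h) y‖ := by ring
      _ ≤ p h + q h := by
        refine add_le_add (le_trans ?_ h3) (h2.trans h4)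
        gcongr
        exact h1
  | succ j ih =>
    obtain ⟨σ, _, L, F', P, hL⟩ := exists_hasFDerivAt_augmentFun (A := A) F
    choose q hq hq' using fun s => ih (F' s)
    refine ⟨∑ s, ‖L s‖₊ • (q s).comp (P s).toLinearMap, ?_, fun h u => ?_⟩
    · have : Continuous fun h => ∑ s, ‖L s‖ * q s (P s h) :=
        continuous_finsetSum _ fun s _ => continuous_const.mul ((hq s).comp (P s).continuous)
      exact this.congr fun h => by rw [sum_apply]; rfl
    · rw [sum_apply]
      calc _ ≤ ‖u‖ ^ m * ∑ s, ‖L s‖ * ‖iteratedFDeriv ℝ j (augmentFun (F' s) (P s h)) u‖ := by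
            gcongr
            exact norm_iteratedFDeriv_succ_le_sum L (fun s => contDiff_augmentFun _ _) (hL h) j u
        _ = ∑ s, ‖L s‖ * (‖u‖ ^ m *
              ‖iteratedFDeriv ℝ j (augmentFun (F' s) (P s h)) u‖) := by
            rw [Finset.mul_sum]
            exact Finset.sum_congr rfl fun s _ => by ring
        _ ≤ ∑ s, ‖L s‖ * q s (P s h) := by
            gcongr with s
            exact hq' s (P s h) u

/-- The augmentation of `F` by parameter variables in `A`. -/
def augment (F : 𝓢(B, ℂ) →L[ℂ] 𝓢(C, ℂ)) : 𝓢(A × B, ℂ) →L[ℂ] 𝓢(A × C, ℂ) :=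
  mkCLM (augmentFun F) (fun f g u => by simp [augmentFun]) (fun a f u => by simp [augmentFun])
    (contDiff_augmentFun F) (by
      rintro ⟨m, j⟩
      obtain ⟨q, hq, hq'⟩ := exists_norm_pow_mul_iteratedFDeriv_augmentFun_le (A := A) F m j
      obtain ⟨s, D, -, hD⟩ :=
        Seminorm.bound_of_continuous (schwartz_withSeminorms ℂ (A × B) ℂ) q hq
      exact ⟨s, D, D.2, fun h u => (hq' h u).trans (hD h)⟩)

theorem augment_apply (F : 𝓢(B, ℂ) →L[ℂ] 𝓢(C, ℂ)) (h : 𝓢(A × B, ℂ)) (x : A) (y : C) :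
    augment F h (x, y) = F (slice x h) y := rfl

end Augment

section Jet

variable {V : Type*} [NormedAddCommGroup V] [NormedSpace ℝ V]

variable (V) in
/-- Bounded continuous functions valued in `j`-linear forms. -/
def BoundedForms (j : ℕ) : Type _ := BoundedContinuousFunction V (V [×j]→L[ℝ] ℂ)

instance (j : ℕ) : NormedAddCommGroup (BoundedForms V j) :=
  inferInstanceAs (NormedAddCommGroup (BoundedContinuousFunction V (V [×j]→L[ℝ] ℂ)))

instance (j : ℕ) : NormedSpace ℝ (BoundedForms V j) :=
  inferInstanceAs (NormedSpace ℝ (BoundedContinuousFunction V (V [×j]→L[ℝ] ℂ)))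

instance (j : ℕ) : CompleteSpace (BoundedForms V j) :=
  inferInstanceAs (CompleteSpace (BoundedContinuousFunction V (V [×j]→L[ℝ] ℂ)))

instance (j : ℕ) : FunLike (BoundedForms V j) V (V [×j]→L[ℝ] ℂ) :=
  inferInstanceAs (FunLike (BoundedContinuousFunction V (V [×j]→L[ℝ] ℂ)) V (V [×j]→L[ℝ] ℂ))

variable (V) in
/-- Tuples of bounded continuous functions valued in `j`-linear forms for `j ≤ N`. -/
def JetSpace (N : ℕ) : Type _ := ∀ j : Fin (N + 1), BoundedForms V j

instance (N : ℕ) : NormedAddCommGroup (JetSpace V N) :=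
  inferInstanceAs (NormedAddCommGroup (∀ j : Fin (N + 1), BoundedForms V j))

instance (N : ℕ) : NormedSpace ℝ (JetSpace V N) :=
  inferInstanceAs (NormedSpace ℝ (∀ j : Fin (N + 1), BoundedForms V j))

instance (N : ℕ) : CompleteSpace (JetSpace V N) :=
  inferInstanceAs (CompleteSpace (∀ j : Fin (N + 1), BoundedForms V j))

theorem exists_weightedDeriv_bound (M j : ℕ) (f : 𝓢(V, ℂ)) (x : V) :
    ‖(1 + ‖x‖) ^ M • iteratedFDeriv ℝ j f x‖
      ≤ 2 ^ M * (Finset.Iic (M, j)).sup (fun m => SchwartzMap.seminorm ℝ m.1 m.2) f := by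
  rw [norm_smul, Real.norm_of_nonneg (by positivity)]
  exact one_add_le_sup_seminorm_apply (𝕜 := ℝ) (m := (M, j)) le_rfl le_rfl f x

/-- The weighted derivative `x ↦ (1 + ‖x‖) ^ M • D^j f x` as a bounded continuous function. -/
def weightedDeriv (M j : ℕ) : 𝓢(V, ℂ) →L[ℝ] BoundedForms V j :=
  mkCLMtoNormedSpace (𝕜 := ℝ) (σ := RingHom.id ℝ) (G := BoundedForms V j)
    (fun f => BoundedContinuousFunction.ofNormedAddCommGroup
      (fun x : V => (1 + ‖x‖) ^ M • iteratedFDeriv ℝ j f x)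
      (by have := (f.differentiable_iteratedFDeriv j).continuous; fun_prop)
      _ (exists_weightedDeriv_bound M j f))
    (fun f g => by
      refine BoundedContinuousFunction.ext fun x => ?_
      have := iteratedFDeriv_add_apply (x := x) (f.smooth j).contDiffAt (g.smooth j).contDiffAt
      exact (congrArg ((1 + ‖x‖) ^ M • ·) this).trans (smul_add _ _ _))
    (fun a f => by
      refine BoundedContinuousFunction.ext fun x => ?_
      have := iteratedFDeriv_const_smul_apply (x := x) (a := a) (f.smooth j).contDiffAt
      exact (congrArg ((1 + ‖x‖) ^ M • ·) this).trans (smul_comm _ _ _))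
    ⟨Finset.Iic (M, j), 2 ^ M, by positivity, fun f =>
      BoundedContinuousFunction.norm_ofNormedAddCommGroup_le _ (by positivity) _⟩

theorem weightedDeriv_apply (M j : ℕ) (f : 𝓢(V, ℂ)) (x : V) :
    weightedDeriv M j f x = (1 + ‖x‖) ^ M • iteratedFDeriv ℝ j f x := rfl

/-- All weighted derivatives of order at most `N`. -/
def jet (M N : ℕ) :
    𝓢(V, ℂ) →L[ℝ] JetSpace V N :=
  ContinuousLinearMap.pi fun j : Fin (N + 1) => weightedDeriv M j

theorem seminorm_le_norm_jet {M N m j : ℕ} (hm : m ≤ M) (hj : j ≤ N) (f : 𝓢(V, ℂ)) :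
    SchwartzMap.seminorm ℂ m j f ≤ ‖jet M N f‖ := by
  refine seminorm_le_bound ℂ m j f (norm_nonneg _) fun x => ?_
  calc ‖x‖ ^ m * ‖iteratedFDeriv ℝ j f x‖
      ≤ (1 + ‖x‖) ^ M * ‖iteratedFDeriv ℝ j f x‖ := by
        gcongr
        have := norm_nonneg x
        exact (pow_le_pow_left₀ this (by linarith) m).trans
          (pow_le_pow_right₀ (by linarith) hm)
    _ = ‖weightedDeriv M j f x‖ := by
        rw [weightedDeriv_apply, norm_smul, Real.norm_of_nonneg (by positivity)]
    _ ≤ ‖weightedDeriv M j f‖ := BoundedContinuousFunction.norm_coe_le_norm _ x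
    _ ≤ ‖jet M N f‖ := norm_le_pi_norm (jet M N f) (⟨j, Nat.lt_succ_of_le hj⟩ : Fin (N + 1))

theorem exists_norm_clm_le_norm_jet (T : 𝓢(V, ℂ) →L[ℂ] ℂ) :
    ∃ (M N : ℕ) (D : ℝ), ∀ f, ‖T f‖ ≤ D * ‖jet M N f‖ := by
  obtain ⟨s, C, -, hC⟩ := Seminorm.bound_of_continuous (schwartz_withSeminorms ℂ V ℂ)
    ((normSeminorm ℂ ℂ).comp T.toLinearMap) (continuous_norm.comp T.continuous)
  refine ⟨s.sup Prod.fst, s.sup Prod.snd, C, fun f => (hC f).trans ?_⟩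
  rw [smul_apply, NNReal.smul_def, smul_eq_mul]
  gcongr
  exact Seminorm.finset_sup_apply_le (norm_nonneg _) fun i hi =>
    seminorm_le_norm_jet (Finset.le_sup (f := Prod.fst) hi) (Finset.le_sup (f := Prod.snd) hi) f

theorem _root_.dist_inv_smul_le {E : Type*} [SeminormedAddCommGroup E] [NormedSpace ℝ E] {c : ℝ}
    (hc : 1 ≤ c) (a b : E) : dist (c⁻¹ • a) b ≤ dist a (c • b) := by
  have h0 : 0 < c := one_pos.trans_le hc
  conv_lhs => rw [← inv_smul_smul₀ h0.ne' b]
  rw [dist_smul₀, Real.norm_of_nonneg (by positivity)]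
  exact mul_le_of_le_one_left dist_nonneg (inv_le_one_of_one_le₀ hc)

theorem eq_zero_of_mem_closure_range_jet {M N : ℕ}
    {G : JetSpace V N}
    (hG : G ∈ closure (Set.range (jet M N))) (h0 : G 0 = 0) : G = 0 := by
  obtain ⟨u, hu, hlim⟩ := mem_closure_iff_seq_limit.1 hG
  choose f hf using hu
  obtain rfl : (fun i => jet M N (f i)) = u := funext hf
  have hunif (j : ℕ) (hj : j < N + 1) : TendstoUniformly (fun i x => iteratedFDeriv ℝ j (f i) x)
      (fun x => ((1 + ‖x‖) ^ M)⁻¹ • G ⟨j, hj⟩ x) atTop := by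
    have h1 : Tendsto (fun i => weightedDeriv M j (f i)) atTop (𝓝 (G ⟨j, hj⟩)) :=
      tendsto_pi_nhds.1 hlim ⟨j, hj⟩
    have h2 : TendstoUniformly (fun i => ⇑(weightedDeriv M j (f i))) (G ⟨j, hj⟩) atTop :=
      BoundedContinuousFunction.tendsto_iff_tendstoUniformly.1 h1
    rw [Metric.tendstoUniformly_iff] at h2
    rw [Metric.tendstoUniformly_iff]
    intro ε hε
    filter_upwards [h2 ε hε] with i hi x
    refine lt_of_le_of_lt ?_ (hi x)
    have hx1 : 1 ≤ (1 + ‖x‖) ^ M := one_le_pow₀ (by linarith [norm_nonneg x])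
    rw [weightedDeriv_apply]
    exact dist_inv_smul_le hx1 (G ⟨j, hj⟩ x : V [×j]→L[ℝ] ℂ) (iteratedFDeriv ℝ j (f i) x)
  have key (j : ℕ) (hj : j < N + 1) : G ⟨j, hj⟩ = 0 := by
    induction j with
    | zero => exact h0
    | succ j ih =>
      have hj' : j < N + 1 := Nat.lt_of_succ_lt hj
      let e := continuousMultilinearCurryLeftEquiv ℝ (fun _ : Fin (j + 1) => V) ℂ
      have hd (x : V) : HasFDerivAt (fun x : V => ((1 + ‖x‖) ^ M)⁻¹ • G ⟨j, hj'⟩ x)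
          (e (((1 + ‖x‖) ^ M)⁻¹ • G ⟨j + 1, hj⟩ x)) x := by
        refine hasFDerivAt_of_tendstoUniformly (l := atTop)
          (f := fun i => iteratedFDeriv ℝ j (f i))
          (f' := fun i x => e (iteratedFDeriv ℝ (j + 1) (f i) x))
          (g' := fun x => e (((1 + ‖x‖) ^ M)⁻¹ • G ⟨j + 1, hj⟩ x)) ?_ (fun i x => ?_)
          (fun x => (hunif j hj').tendsto_at x) x
        · exact e.isometry.uniformContinuous.comp_tendstoUniformly (hunif (j + 1) hj)
        · have h1 := ((f i).differentiable_iteratedFDeriv j x).hasFDerivAt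
          rw [fderiv_iteratedFDeriv] at h1
          exact h1
      refine BoundedContinuousFunction.ext fun x => ?_
      have h1 := hd x
      have h0' : (fun x : V => ((1 + ‖x‖) ^ M)⁻¹ • G ⟨j, hj'⟩ x) = fun _ => 0 := by
        rw [ih hj']
        exact funext fun x => smul_zero _
      rw [h0'] at h1
      have h2 := h1.unique (hasFDerivAt_const _ _)
      have hx : 0 < (1 + ‖x‖) ^ M := by positivity
      have h3 := e.injective (h2.trans e.map_zero.symm)
      exact (smul_eq_zero.1 h3).resolve_left (inv_ne_zero hx.ne')
  exact funext fun j => key j j.2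

end Jet

section Tensor

variable {A B : Type*} [NormedAddCommGroup A] [NormedSpace ℝ A]
  [NormedAddCommGroup B] [NormedSpace ℝ B]

theorem norm_pow_mul_iteratedFDeriv_tensor_le (f : 𝓢(A, ℂ)) (g : 𝓢(B, ℂ)) (m n : ℕ)
    (u : A × B) :
    ‖u‖ ^ m * ‖iteratedFDeriv ℝ n (fun u : A × B => f u.1 * g u.2) u‖ ≤
      ∑ i ∈ Finset.range (n + 1), (n.choose i : ℝ) *
        (SchwartzMap.seminorm ℝ m i f * SchwartzMap.seminorm ℝ 0 (n - i) g
          + SchwartzMap.seminorm ℝ 0 i f * SchwartzMap.seminorm ℝ m (n - i) g) := by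
  obtain ⟨x, z⟩ := u
  have hf : ContDiff ℝ n fun u : A × B => f u.1 := (f.smooth n).comp contDiff_fst
  have hg : ContDiff ℝ n fun u : A × B => g u.2 := (g.smooth n).comp contDiff_snd
  refine (mul_le_mul_of_nonneg_left (norm_iteratedFDeriv_mul_le (𝕜 := ℝ) hf hg (x, z) le_rfl)
    (by positivity)).trans ?_
  rw [Finset.mul_sum]
  refine Finset.sum_le_sum fun i _ => ?_
  have h1 : ‖iteratedFDeriv ℝ i (fun u : A × B => f u.1) (x, z)‖
      ≤ ‖iteratedFDeriv ℝ i f x‖ :=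
    norm_iteratedFDeriv_comp_le_of_norm_le_one
      (ContinuousLinearMap.norm_fst_le ℝ A B) f i (x, z)
  have h2 : ‖iteratedFDeriv ℝ (n - i) (fun u : A × B => g u.2) (x, z)‖
      ≤ ‖iteratedFDeriv ℝ (n - i) g z‖ :=
    norm_iteratedFDeriv_comp_le_of_norm_le_one
      (ContinuousLinearMap.norm_snd_le ℝ A B) g (n - i) (x, z)
  have h3 : ‖(x, z)‖ ^ m ≤ ‖x‖ ^ m + ‖z‖ ^ m := norm_prod_pow_le x z m
  have h4 := f.le_seminorm ℝ m i x
  have h5 := f.le_seminorm ℝ 0 i x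
  have h6 := g.le_seminorm ℝ m (n - i) z
  have h7 := g.le_seminorm ℝ 0 (n - i) z
  rw [pow_zero, one_mul] at h5 h7
  calc _ ≤ (‖x‖ ^ m + ‖z‖ ^ m) * ((n.choose i : ℝ) *
        ‖iteratedFDeriv ℝ i f x‖ * ‖iteratedFDeriv ℝ (n - i) g z‖) := by gcongr
    _ = (n.choose i : ℝ) * ((‖x‖ ^ m * ‖iteratedFDeriv ℝ i f x‖) *
        ‖iteratedFDeriv ℝ (n - i) g z‖ + ‖iteratedFDeriv ℝ i f x‖ *
        (‖z‖ ^ m * ‖iteratedFDeriv ℝ (n - i) g z‖)) := by ring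
    _ ≤ _ := by gcongr

/-- The tensor product `(x, z) ↦ f x * g z` of Schwartz functions. -/
def tensor (f : 𝓢(A, ℂ)) (g : 𝓢(B, ℂ)) : 𝓢(A × B, ℂ) where
  toFun u := f u.1 * g u.2
  smooth' := ((f.smooth _).comp contDiff_fst).mul ((g.smooth _).comp contDiff_snd)
  decay' m n := ⟨_, norm_pow_mul_iteratedFDeriv_tensor_le f g m n⟩

/-- The map `(t, (x, z)) ↦ (x - t, (t, z))`. -/
def shearEquiv (A B : Type*) [NormedAddCommGroup A] [NormedSpace ℝ A]
    [NormedAddCommGroup B] [NormedSpace ℝ B] : (A × A × B) ≃L[ℝ] (A × A × B) :=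
  { toFun := fun u => (u.2.1 - u.1, u.1, u.2.2)
    invFun := fun u => (u.2.1, u.1 + u.2.1, u.2.2)
    map_add' := fun u v => by ext <;> simp; abel
    map_smul' := fun r u => by ext <;> simp [smul_sub]
    left_inv := fun u => by simp
    right_inv := fun u => by simp
    continuous_toFun := by fun_prop
    continuous_invFun := by fun_prop }

theorem exists_slice_eq_shift_mul (φ : 𝓢(A, ℂ)) (h : 𝓢(A × B, ℂ)) :
    ∃ Φ : 𝓢(A × A × B, ℂ), ∀ t x z, slice t Φ (x, z) = φ (x - t) * h (t, z) :=
  ⟨compCLMOfContinuousLinearEquiv ℂ (shearEquiv A B) (tensor φ h), fun t x z => by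
    rw [slice_apply]; rfl⟩

end Tensor

theorem _root_.Submodule.integral_mem_of_isClosed {X Y : Type*} [NormedAddCommGroup X]
    [NormedSpace ℝ X] [CompleteSpace X] [MeasurableSpace Y] {μ : Measure Y} {K : Submodule ℝ X}
    (hK : IsClosed (K : Set X)) {f : Y → X} (hf : ∀ y, f y ∈ K) : ∫ y, f y ∂μ ∈ K := by
  by_cases hi : Integrable f μ
  · have : IsClosed (K : Set X) := hK
    rw [← Submodule.Quotient.mk_eq_zero K]
    have h := K.mkQL.integral_comp_comm hi
    have h0 : (fun y => K.mkQL (f y)) = fun _ => 0 :=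
      funext fun y => (Submodule.Quotient.mk_eq_zero K).2 (hf y)
    rw [h0, integral_zero] at h
    exact h.symm
  · rw [integral_undef hi]
    exact K.zero_mem

section Density

section Eval

variable {V : Type*} [NormedAddCommGroup V] [NormedSpace ℝ V]

/-- Evaluation of the component of order zero at a point. -/
def jetEval (N : ℕ) (u : V) : JetSpace V N →L[ℝ] ℂ :=
  ((ContinuousMultilinearMap.apply ℝ (fun _ : Fin 0 => V) ℂ 0).comp
    (BoundedContinuousFunction.evalCLM ℝ u)).comp
    (ContinuousLinearMap.proj (R := ℝ) (φ := fun j : Fin (N + 1) =>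
      BoundedContinuousFunction V (V [×j]→L[ℝ] ℂ)) 0)

theorem jetEval_jet (M N : ℕ) (u : V) (f : 𝓢(V, ℂ)) :
    jetEval N u (jet M N f) = (1 + ‖u‖) ^ M • f u := rfl

theorem eq_of_jetEval_eq {M N : ℕ} {G G' : JetSpace V N}
    (hG : G ∈ closure (Set.range (jet M N))) (hG' : G' ∈ closure (Set.range (jet M N)))
    (h : ∀ u, jetEval N u G = jetEval N u G') : G = G' := by
  have hcl : closure (Set.range (jet M N)) =
      ((LinearMap.range (jet (V := V) M N).toLinearMap).topologicalClosure :
        Set (JetSpace V N)) := rfl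
  rw [hcl] at hG hG'
  have hsub := Submodule.sub_mem _ hG hG'
  refine sub_eq_zero.1 (eq_zero_of_mem_closure_range_jet (M := M) hsub ?_)
  refine BoundedContinuousFunction.ext fun u => ContinuousMultilinearMap.ext fun v => ?_
  have h1 : jetEval N u (G - G') = 0 := by rw [map_sub, h, sub_self]
  obtain rfl : v = 0 := funext fun i : Fin 0 => i.elim0
  exact h1

end Eval

variable {A B : Type*} [NormedAddCommGroup A] [InnerProductSpace ℝ A] [FiniteDimensional ℝ A]
  [MeasurableSpace A] [BorelSpace A] [NormedAddCommGroup B] [NormedSpace ℝ B]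

theorem integrable_clm_slice {X : Type*} [NormedAddCommGroup X] [NormedSpace ℝ X]
    (L : 𝓢(B, ℂ) →L[ℝ] X) (h : 𝓢(A × B, ℂ)) :
    Integrable fun x : A => L (slice x h) := by
  have hq : Continuous ((normSeminorm ℝ X).comp L.toLinearMap) :=
    continuous_norm.comp L.continuous
  have hc : Continuous fun x : A => L (slice x h) := L.continuous.comp (continuous_slice h)
  obtain ⟨p, -, hp⟩ := exists_norm_pow_mul_slice_le (A := A) hq 0
  obtain ⟨p', -, hp'⟩ := exists_norm_pow_mul_slice_le (A := A) hq
    (0 + (volume : Measure A).integrablePower)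
  have h1 := integrable_of_le_of_pow_mul_le (μ := (volume : Measure A)) (k := 0)
    (f := fun x => L (slice x h)) (C₁ := p h) (C₂ := p' h)
    (fun x => by simpa using hp h x) (fun x => hp' h x) hc.aestronglyMeasurable
  refine (integrable_norm_iff hc.aestronglyMeasurable).1 ?_
  simpa using h1

/-- A smooth bump function, normalised, as a Schwartz function. -/
def ofBump (φ : ContDiffBump (0 : A)) : 𝓢(A, ℂ) :=
  HasCompactSupport.toSchwartzMap (f := fun x => ((φ.normed volume x : ℝ) : ℂ))
    (φ.hasCompactSupport_normed.comp_left Complex.ofReal_zero)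
    (Complex.ofRealCLM.contDiff.comp φ.contDiff_normed)

theorem ofBump_apply (φ : ContDiffBump (0 : A)) (x : A) : ofBump φ x = (φ.normed volume x : ℝ) :=
  rfl

theorem integral_jet_slice_eq_convolution (M N : ℕ) (φ : ContDiffBump (0 : A))
    (h : 𝓢(A × B, ℂ)) {Φ : 𝓢(A × A × B, ℂ)}
    (hΦ : ∀ t x z, slice t Φ (x, z) = ofBump φ (x - t) * h (t, z)) :
    ∫ t, jet M N (slice t Φ) =
      (φ.normed volume ⋆[ContinuousLinearMap.lsmul ℝ ℝ, volume]
        fun s : A => jet M N (shift (s, 0) h)) 0 := by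
  rw [convolution_def]
  have hi := integrable_clm_slice (jet M N) Φ
  have hc : Continuous fun s : A => jet M N (shift (s, 0) h) :=
    (jet M N).continuous.comp ((continuous_shift h).comp (by fun_prop))
  have hi' : Integrable fun t : A =>
      ContinuousLinearMap.lsmul ℝ ℝ (φ.normed volume t) (jet M N (shift (0 - t, 0) h)) := by
    refine Continuous.integrable_of_hasCompactSupport ?_ ?_
    · exact φ.continuous_normed.smul (hc.comp (by fun_prop))
    · exact φ.hasCompactSupport_normed.smul_right
  have hcl : closure (Set.range (jet M N)) =
      ((LinearMap.range (jet (V := A × B) M N).toLinearMap).topologicalClosure :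
        Set (JetSpace (A × B) N)) := rfl
  refine eq_of_jetEval_eq (M := M) ?_ ?_ fun u => ?_
  · rw [hcl]
    exact Submodule.integral_mem_of_isClosed (Submodule.isClosed_topologicalClosure _)
      fun t => Submodule.le_topologicalClosure _ (LinearMap.mem_range_self _ _)
  · rw [hcl]
    exact Submodule.integral_mem_of_isClosed (Submodule.isClosed_topologicalClosure _)
      fun t => Submodule.smul_mem _ _
        (Submodule.le_topologicalClosure _ (LinearMap.mem_range_self _ _))
  · obtain ⟨x, z⟩ := u
    rw [← ContinuousLinearMap.integral_comp_comm _ hi,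
      ← ContinuousLinearMap.integral_comp_comm _ hi', ← integral_sub_left_eq_self _ volume x]
    refine integral_congr_ae (Eventually.of_forall fun t => ?_)
    simp only [ContinuousLinearMap.lsmul_apply, map_smul, jetEval_jet, hΦ, sub_sub_cancel,
      ofBump_apply, shift_apply, Prod.mk_add_mk, add_zero, zero_sub, Complex.real_smul,
      ← sub_eq_add_neg]
    ring

theorem clm_eq_zero_of_tensor {T : 𝓢(A × B, ℂ) →L[ℂ] ℂ}
    (hT : ∀ (f : 𝓢(A, ℂ)) (g : 𝓢(B, ℂ)) (w : 𝓢(A × B, ℂ)),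
      (∀ x z, w (x, z) = f x * g z) → T w = 0) (h : 𝓢(A × B, ℂ)) : T h = 0 := by
  obtain ⟨M, N, D, hD⟩ := exists_norm_clm_le_norm_jet T
  let K := ((LinearMap.ker (T.restrictScalars ℝ).toLinearMap).map
    (jet M N).toLinearMap).topologicalClosure
  have hK : IsClosed (K : Set (JetSpace (A × B) N)) := Submodule.isClosed_topologicalClosure _
  have hconv (φ : ContDiffBump (0 : A)) :
      (φ.normed volume ⋆[ContinuousLinearMap.lsmul ℝ ℝ, volume]
        fun s : A => jet M N (shift (s, 0) h)) 0 ∈ K := by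
    obtain ⟨Φ, hΦ⟩ := exists_slice_eq_shift_mul (ofBump φ) h
    rw [← integral_jet_slice_eq_convolution M N φ h hΦ]
    refine Submodule.integral_mem_of_isClosed hK fun t =>
      Submodule.le_topologicalClosure _ (Submodule.mem_map_of_mem ?_)
    exact hT (shift (-t) (ofBump φ)) (slice t h) _ fun x z => by
      rw [hΦ, shift_apply, slice_apply, sub_eq_add_neg]
  let φ (i : ℕ) : ContDiffBump (0 : A) :=
    ⟨1 / ((i : ℝ) + 1) / 2, 1 / ((i : ℝ) + 1), by positivity, half_lt_self (by positivity)⟩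
  have hc : Continuous fun s : A => jet M N (shift (s, 0) h) :=
    (jet M N).continuous.comp ((continuous_shift h).comp (by fun_prop))
  have hlim := ContDiffBump.convolution_tendsto_right_of_continuous (μ := volume) (φ := φ)
    tendsto_one_div_add_atTop_nhds_zero_nat hc 0
  have hmem : jet M N h ∈ K := by
    have h1 := hK.mem_of_tendsto hlim (Eventually.of_forall fun i => hconv (φ i))
    have h2 : shift ((0 : A), (0 : B)) h = h := by
      ext u
      rw [shift_apply, Prod.mk_zero_zero, add_zero]
    rwa [h2] at h1
  obtain ⟨v, hv, hvlim⟩ := mem_closure_iff_seq_limit.1 hmem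
  choose f hf hfv using hv
  have h0 : Tendsto (fun i => D * ‖jet M N h - v i‖) atTop (𝓝 0) := by
    have := ((tendsto_const_nhds (x := jet M N h)).sub hvlim).norm.const_mul D
    simpa using this
  refine norm_le_zero_iff.1 (ge_of_tendsto' h0 fun i => ?_)
  have h3 : T (f i) = 0 := hf i
  have h4 : jet M N (f i) = v i := hfv i
  rw [← h4, ← map_sub]
  refine le_trans (le_of_eq ?_) (hD (h - f i))
  rw [map_sub, h3, sub_zero]

end Density

end SchwartzMap

/-- (Augmentation by parameter variables.) For a continuous linear map
`F : 𝓢(ℝⁿ) → 𝓢(ℝᵐ)` there is a unique continuous linear map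
`E : 𝓢(ℝ^{k+n}) → 𝓢(ℝ^{k+m})` with `E (f ⊠ g) = f ⊠ F g` on tensor products; moreover it is
given explicitly by `E h (x, y) = F (z ↦ h (x, z)) (y)`. -/
theorem statement4 (n m k : ℕ)
    (F : SchwartzMap (Euc n) ℂ →L[ℂ] SchwartzMap (Euc m) ℂ) :
    ∃ E : SchwartzMap (Euc k × Euc n) ℂ →L[ℂ] SchwartzMap (Euc k × Euc m) ℂ,
      (∀ (f : SchwartzMap (Euc k) ℂ) (g : SchwartzMap (Euc n) ℂ)
          (w : SchwartzMap (Euc k × Euc n) ℂ),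
          (∀ (x : Euc k) (z : Euc n), w (x, z) = f x * g z) →
          ∀ (x : Euc k) (y : Euc m), E w (x, y) = f x * F g y) ∧
      (∀ (h : SchwartzMap (Euc k × Euc n) ℂ) (x : Euc k) (hx : SchwartzMap (Euc n) ℂ),
          (∀ z : Euc n, hx z = h (x, z)) →
          ∀ y : Euc m, E h (x, y) = F hx y) ∧
      (∀ E' : SchwartzMap (Euc k × Euc n) ℂ →L[ℂ] SchwartzMap (Euc k × Euc m) ℂ,
          (∀ (f : SchwartzMap (Euc k) ℂ) (g : SchwartzMap (Euc n) ℂ)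
              (w : SchwartzMap (Euc k × Euc n) ℂ),
              (∀ (x : Euc k) (z : Euc n), w (x, z) = f x * g z) →
              ∀ (x : Euc k) (y : Euc m), E' w (x, y) = f x * F g y) →
          E' = E) := by
  have hE (f : SchwartzMap (Euc k) ℂ) (g : SchwartzMap (Euc n) ℂ)
      (w : SchwartzMap (Euc k × Euc n) ℂ)
      (hw : ∀ (x : Euc k) (z : Euc n), w (x, z) = f x * g z) (x : Euc k) (y : Euc m) :
      SchwartzMap.augment F w (x, y) = f x * F g y := by
    have h1 : SchwartzMap.slice x w = f x • g := by
      ext z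
      rw [SchwartzMap.slice_apply, hw, smul_apply, smul_eq_mul]
    rw [SchwartzMap.augment_apply, h1, map_smul, smul_apply, smul_eq_mul]
  refine ⟨SchwartzMap.augment F, hE, fun h x hx hh y => ?_, fun E' hE' => ?_⟩
  · have h1 : SchwartzMap.slice x h = hx := by
      ext z
      rw [SchwartzMap.slice_apply, hh]
    rw [SchwartzMap.augment_apply, h1]
  · ext h u
    let ev : SchwartzMap (Euc k × Euc m) ℂ →L[ℂ] ℂ :=
      (BoundedContinuousFunction.evalCLM ℂ u).comp
        (SchwartzMap.toBoundedContinuousFunctionCLM ℂ (Euc k × Euc m) ℂ)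
    have hT := SchwartzMap.clm_eq_zero_of_tensor (T := ev.comp (E' - SchwartzMap.augment F))
      (fun f g w hw => ?_) h
    · exact sub_eq_zero.1 hT
    · change E' w u - SchwartzMap.augment F w u = 0
      rw [← Prod.mk.eta (p := u), hE' f g w hw, hE f g w hw, sub_self]
end
end
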